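/- arXiv:2508.16137 — 5 statements merged into one kernel-verified Lean document; each statement's English description precedes it below -/
import Mathlib

section
/- Let (R, m) be a Cohen–Macaulay local ring of dimension d, and let M be a maximal Cohen–Macaulay R-module. If x₁, …, x_d is a system of parameters of R contained in the stable annihilator of M, then M is a direct summand of the d-th syzygy Ω_R^d(M/(x₁,…,x_d)M). -/
open IsLocalRing

/-- a lies in the stable annihilator of M: multiplication by a on M factors
through a finitely generated projective R-module. -/
def StablyAnn (R : Type) [CommRing R] (M : Type) [AddCommGroup M] [Module R M] (a : R) : Prop :=
  ∃ (P : Type) (_ : AddCommGroup P) (_ : Module R P),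
    Module.Finite R P ∧ Module.Projective R P ∧
    ∃ (f : M →ₗ[R] P) (g : P →ₗ[R] M), g ∘ₗ f = a • (LinearMap.id : M →ₗ[R] M)

/-- The Ext module of two module-category objects. -/
noncomputable def ExtMod (R : Type) [CommRing R] (n : ℕ) (M N : ModuleCat.{0} R) : ModuleCat R :=
  ((Ext R (ModuleCat.{0} R) n).obj (Opposite.op M)).obj N

/-- K is an n-th syzygy of M: there is an exact sequence
0 → K → F_{n-1} → ... → F_0 → M → 0 with finitely generated free modules F_i. -/
def IsSyzygyCat (R : Type) [CommRing R] : ℕ → ModuleCat.{0} R → ModuleCat.{0} R → Prop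
  | 0, K, M => Nonempty (K ≃ₗ[R] M)
  | n + 1, K, M =>
      ∃ (s : ℕ) (p : (Fin s → R) →ₗ[R] M), Function.Surjective p ∧
        IsSyzygyCat R n K (ModuleCat.of R (LinearMap.ker p))

/-- M is a direct summand of Z. -/
def IsSummand (R : Type) [CommRing R] (M Z : ModuleCat.{0} R) : Prop :=
  ∃ (i : M →ₗ[R] Z) (p : Z →ₗ[R] M), p ∘ₗ i = LinearMap.id

/-- The class |X|_n of modules built from X by n-1 extensions together with
finite direct sums and direct summands. -/
def Ball (R : Type) [CommRing R] (X : ModuleCat.{0} R) : ℕ → ModuleCat.{0} R → Prop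
  | 0, M => Subsingleton M
  | 1, M => ∃ s : ℕ, IsSummand R M (ModuleCat.of R (Fin s → X))
  | (n + 2), M =>
      ∃ (A Z B : ModuleCat.{0} R) (f : A →ₗ[R] Z) (g : Z →ₗ[R] B),
        Function.Injective f ∧ Function.Surjective g ∧ LinearMap.range f = LinearMap.ker g ∧
        Ball R X (n + 1) A ∧ Ball R X 1 B ∧ IsSummand R M Z


section

open CategoryTheory

/-! ### Vanishing of cohomology computed by a projective resolution -/

/-- The complex `Hom(P, N)` is exact in degrees below `n`. -/
def HomExactBelow {C : Type*} [Category C] [Preadditive C] (P : ChainComplex C ℕ) (N : C)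
    (n : ℕ) : Prop :=
  ∀ i < n, ∀ f : P.X i ⟶ N, P.d (i + 1) i ≫ f = 0 → ∃ (j : ℕ) (g : P.X j ⟶ N), f = P.d i j ≫ g

lemma HomExactBelow.of_iso {C : Type*} [Category C] [Preadditive C] {P : ChainComplex C ℕ}
    {N N' : C} {n : ℕ} (h : HomExactBelow P N n) (e : N ≅ N') : HomExactBelow P N' n := by
  intro i hi f hf
  obtain ⟨j, g, hg⟩ := h i hi (f ≫ e.inv) (by rw [← Category.assoc, hf, Limits.zero_comp])
  exact ⟨j, g ≫ e.hom, by rw [← Category.assoc, ← hg]; simp⟩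

lemma HomExactBelow.exists_eq {C : Type*} [Category C] [Preadditive C] {P : ChainComplex C ℕ}
    {N : C} {n : ℕ} (h : HomExactBelow P N n) {i : ℕ} (hi : i + 1 < n) (f : P.X (i + 1) ⟶ N)
    (hf : P.d (i + 2) (i + 1) ≫ f = 0) : ∃ g : P.X i ⟶ N, f = P.d (i + 1) i ≫ g := by
  obtain ⟨j, g, rfl⟩ := h _ hi f hf
  by_cases hj : j = i
  · subst hj
    exact ⟨g, rfl⟩
  · refine ⟨0, ?_⟩
    rw [P.shape (i + 1) j (by simpa using hj)]
    simp

/-- Dimension shifting along a short exact sequence. -/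
lemma HomExactBelow.of_shortExact {C : Type*} [Category C] [Abelian C] {P : ChainComplex C ℕ}
    [∀ i, Projective (P.X i)] {S : ShortComplex C} (hS : S.ShortExact) {n : ℕ}
    (h₁ : HomExactBelow P S.X₁ (n + 1)) (h₂ : HomExactBelow P S.X₂ (n + 1)) :
    HomExactBelow P S.X₃ n := by
  intro i hi f hf
  have := hS.mono_f
  have := hS.epi_g
  obtain ⟨f', rfl⟩ : ∃ f' : P.X i ⟶ S.X₂, f' ≫ S.g = f :=
    ⟨Projective.factorThru f S.g, Projective.factorThru_comp f S.g⟩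
  obtain ⟨h, hh⟩ : ∃ h : P.X (i + 1) ⟶ S.X₁, h ≫ S.f = P.d (i + 1) i ≫ f' :=
    ⟨hS.exact.lift (P.d (i + 1) i ≫ f') (by simpa using hf), hS.exact.lift_f _ _⟩
  obtain ⟨g, rfl⟩ := h₁.exists_eq (by omega : i + 1 < n + 1) h (by
    rw [← cancel_mono S.f, Category.assoc, hh]
    simp)
  obtain ⟨j, e, he⟩ := h₂ i (by omega) (f' - g ≫ S.f) (by
    rw [Preadditive.comp_sub, ← hh]
    simp)
  refine ⟨j, e ≫ S.g, ?_⟩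
  rw [← Category.assoc, ← he]
  simp

lemma homExactBelow_of_subsingleton_extMod {R : Type} [CommRing R] {X N : ModuleCat.{0} R}
    (P : ProjectiveResolution X) {n : ℕ} (h : ∀ i < n, Subsingleton (ExtMod R i X N)) :
    HomExactBelow P.complex N n := by
  intro i hi f hf
  have hsub : Subsingleton ((P.complex.linearYonedaObj R N).homology i) :=
    have : Subsingleton (((Ext R (ModuleCat.{0} R) i).obj (Opposite.op X)).obj N) := h i hi
    (P.isoExt (R := R) i N).toLinearEquiv.symm.injective.subsingleton
  have hex : (P.complex.linearYonedaObj R N).ExactAt i := by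
    rw [HomologicalComplex.exactAt_iff_isZero_homology]
    exact ModuleCat.isZero_of_subsingleton _
  rw [HomologicalComplex.exactAt_iff' _ ((ComplexShape.up ℕ).prev i) i (i + 1) rfl (by simp),
    ShortComplex.moduleCat_exact_iff] at hex
  obtain ⟨g, hg⟩ := hex f hf
  exact ⟨_, g, hg.symm⟩

lemma HomExactBelow.eq_zero {C : Type*} [Category C] [Abelian C] {X N : C}
    (P : ProjectiveResolution X) {n : ℕ} (h : HomExactBelow P.complex N (n + 1)) (f : X ⟶ N) :
    f = 0 := by
  let π : P.complex.X 0 ⟶ X := P.π.f 0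
  have hπ : P.complex.d 1 0 ≫ π = 0 := P.complex_d_comp_π_f_zero
  have : Epi π := inferInstanceAs (Epi (P.π.f 0))
  obtain ⟨j, g, hg⟩ := h 0 (by omega) (π ≫ f) (by
    rw [← Category.assoc, hπ, Limits.zero_comp])
  rw [P.complex.shape 0 j (by simp), Limits.zero_comp] at hg
  rwa [← cancel_epi π, Limits.comp_zero]

/-- `q` exhibits `N'` as the quotient `N / a N`. -/
structure IsQuotBy {R N N' : Type*} [CommRing R] [AddCommGroup N] [Module R N] [AddCommGroup N']
    [Module R N'] (a : R) (q : N →ₗ[R] N') : Prop where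
  surjective : Function.Surjective q
  map_eq_zero_iff : ∀ n, q n = 0 ↔ ∃ m, a • m = n

open scoped Pointwise in
lemma isQuotBy_mkQ {R N : Type*} [CommRing R] [AddCommGroup N] [Module R N] (a : R) :
    IsQuotBy a (a • (⊤ : Submodule R N)).mkQ where
  surjective := Submodule.mkQ_surjective _
  map_eq_zero_iff n := by simp [Submodule.mem_smul_pointwise_iff_exists]

open scoped Pointwise in
lemma isQuotBy_factor_sup {R M : Type*} [CommRing R] [AddCommGroup M] [Module R M]
    (I : Ideal R) (a : R) :
    IsQuotBy a (Submodule.factor (Submodule.smul_mono_left le_sup_left :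
      I • (⊤ : Submodule R M) ≤ (I ⊔ Ideal.span {a}) • (⊤ : Submodule R M))) where
  surjective := Submodule.factor_surjective _
  map_eq_zero_iff n := by
    obtain ⟨n, rfl⟩ := Submodule.mkQ_surjective _ n
    change Submodule.Quotient.mk n = 0 ↔ _
    have hsup := Submodule.sup_smul I (Ideal.span {a}) (⊤ : Submodule R M)
    rw [Submodule.Quotient.mk_eq_zero, hsup, Submodule.mem_sup]
    simp only [Submodule.mkQ_apply, Submodule.ideal_span_singleton_smul,
      Submodule.mem_smul_pointwise_iff_exists]
    constructor
    · rintro ⟨y, hy, _, ⟨m, -, rfl⟩, rfl⟩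
      refine ⟨Submodule.Quotient.mk m, ?_⟩
      rw [← Submodule.Quotient.mk_smul, Submodule.Quotient.eq]
      simpa using hy
    · rintro ⟨m, hm⟩
      obtain ⟨m, rfl⟩ := Submodule.mkQ_surjective _ m
      rw [Submodule.mkQ_apply, ← Submodule.Quotient.mk_smul, eq_comm, Submodule.Quotient.eq] at hm
      exact ⟨_, hm, _, ⟨m, trivial, rfl⟩, by simp⟩

lemma HomExactBelow.of_isQuotBy {R : Type} [CommRing R] {P : ChainComplex (ModuleCat.{0} R) ℕ}
    [∀ i, Projective (P.X i)] {N N' : Type} [AddCommGroup N] [Module R N] [AddCommGroup N']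
    [Module R N'] {a : R} {q : N →ₗ[R] N'} (hq : IsQuotBy a q) (ha : IsSMulRegular N a) {n : ℕ}
    (h : HomExactBelow P (ModuleCat.of R N) (n + 1)) : HomExactBelow P (ModuleCat.of R N') n := by
  let S : ShortComplex (ModuleCat.{0} R) := ShortComplex.mk
    (ModuleCat.ofHom (LinearMap.lsmul R N a)) (ModuleCat.ofHom q) (by
      ext n
      exact (hq.map_eq_zero_iff _).2 ⟨n, rfl⟩)
  have hS : S.ShortExact :=
    { exact := by
        rw [ShortComplex.moduleCat_exact_iff]
        exact fun n hn => (hq.map_eq_zero_iff n).1 hn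
      mono_f := (ModuleCat.mono_iff_injective _).2 ha
      epi_g := (ModuleCat.epi_iff_surjective _).2 hq.surjective }
  exact HomExactBelow.of_shortExact hS h h

/-! ### Associated primes and regularity of systems of parameters -/

/-- Every associated prime `p` of `N` lies in an associated prime of `N / a N` containing `a`,
for `a` an `N`-regular element of the maximal ideal. -/
lemma exists_le_isAssociatedPrime_of_isQuotBy {R N N' : Type*} [CommRing R] [IsNoetherianRing R]
    [IsLocalRing R] [AddCommGroup N] [Module R N] [Module.Finite R N] [AddCommGroup N']
    [Module R N'] {a : R} {q : N →ₗ[R] N'} (hq : IsQuotBy a q) (ha : IsSMulRegular N a)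
    (ham : a ∈ maximalIdeal R) {p : Ideal R} (hp : IsAssociatedPrime p N) :
    ∃ P : Ideal R, IsAssociatedPrime P N' ∧ p ≤ P ∧ a ∈ P := by
  obtain ⟨hpp, z, hz⟩ := isAssociatedPrime_iff.1 hp
  let U : Submodule R N := Submodule.torsionBySet R N p
  have hzU : z ∈ U := by
    rw [Submodule.mem_torsionBySet_iff]
    rintro ⟨r, hr⟩
    rw [hz] at hr
    simpa [Submodule.mem_colon_singleton] using hr
  obtain ⟨u, huU, hu⟩ : ∃ u ∈ U, q u ≠ 0 := by
    by_contra! hcon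
    have hU : U = ⊥ := by
      refine Submodule.eq_bot_of_le_smul_of_le_jacobson_bot (Ideal.span {a}) U
        (IsNoetherian.noetherian U) ?_ ?_
      · intro u hu
        obtain ⟨v, rfl⟩ := (hq.map_eq_zero_iff u).1 (hcon u hu)
        refine Submodule.smul_mem_smul (Ideal.mem_span_singleton_self a) ?_
        rw [Submodule.mem_torsionBySet_iff] at hu ⊢
        intro r
        refine ha ?_
        simpa [smul_comm a] using hu r
      · rw [IsLocalRing.jacobson_eq_maximalIdeal _ bot_ne_top, Ideal.span_singleton_le_iff_mem]
        exact ham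
    rw [hU, Submodule.mem_bot] at hzU
    subst hzU
    exact hpp.ne_top (by rw [hz]; simp)
  obtain ⟨P, hP, hle⟩ := exists_le_isAssociatedPrime_of_isNoetherianRing R (q u) hu
  refine ⟨P, hP, fun r hr => hle ?_, hle ?_⟩
  · rw [Submodule.mem_colon_singleton, Submodule.mem_bot, ← map_smul,
      (Submodule.mem_torsionBySet_iff _ _).1 huU ⟨r, hr⟩, map_zero]
  · rw [Submodule.mem_colon_singleton, Submodule.mem_bot, ← map_smul]
    exact (hq.map_eq_zero_iff _).2 ⟨u, rfl⟩

lemma IsSMulRegular.notMem_of_isAssociatedPrime {R N : Type*} [CommRing R] [IsNoetherianRing R]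
    [AddCommGroup N] [Module R N] {a : R} (ha : IsSMulRegular N a) {p : Ideal R}
    (hp : IsAssociatedPrime p N) : a ∉ p := by
  intro hap
  obtain ⟨hpp, z, hz⟩ := isAssociatedPrime_iff.1 hp
  rw [hz, Submodule.mem_colon_singleton, Submodule.mem_bot] at hap
  have hz0 : z = 0 := ha (by simpa using hap)
  exact hpp.ne_top (by rw [hz, hz0]; simp)

/-- The depth of `N` bounds the dimension of `R / p` from below for every associated prime `p`. -/
lemma HomExactBelow.le_ringKrullDim_quotient {R : Type} [CommRing R] [IsNoetherianRing R]
    [IsLocalRing R] (P : ProjectiveResolution (ModuleCat.of R (R ⧸ maximalIdeal R))) {n : ℕ}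
    {N : Type} [AddCommGroup N] [Module R N] [Module.Finite R N]
    (h : HomExactBelow P.complex (ModuleCat.of R N) n) {p : Ideal R}
    (hp : IsAssociatedPrime p N) : (n : WithBot ℕ∞) ≤ ringKrullDim (R ⧸ p) := by
  induction n generalizing N p with
  | zero =>
    have := hp.isPrime
    simpa using ringKrullDim_nonneg_of_nontrivial (R := R ⧸ p)
  | succ n ih =>
    have hsub : Subsingleton ((R ⧸ maximalIdeal R) →ₗ[R] N) := by
      refine ⟨fun f g => ?_⟩
      have hf := HomExactBelow.eq_zero P h (ModuleCat.ofHom f)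
      have hg := HomExactBelow.eq_zero P h (ModuleCat.ofHom g)
      exact congrArg ModuleCat.Hom.hom (hf.trans hg.symm)
    obtain ⟨a, ham, ha⟩ := IsSMulRegular.subsingleton_linearMap_iff.1 hsub
    rw [Ideal.annihilator_quotient] at ham
    obtain ⟨Q, hQ, hpQ, haQ⟩ :=
      exists_le_isAssociatedPrime_of_isQuotBy (isQuotBy_mkQ (N := N) a) ha ham hp
    have hle := ih (h.of_isQuotBy (isQuotBy_mkQ (N := N) a) ha) hQ
    have := hp.isPrime
    have hstep := ringKrullDim_succ_le_of_surjective (Ideal.Quotient.factor hpQ)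
      (Ideal.Quotient.factor_surjective hpQ) (r := Ideal.Quotient.mk p a)
      (mem_nonZeroDivisors_of_ne_zero (by
        rw [Ne, Ideal.Quotient.eq_zero_iff_mem]
        exact ha.notMem_of_isAssociatedPrime hp))
      (by simpa [Ideal.Quotient.eq_zero_iff_mem] using haQ)
    refine le_trans ?_ hstep
    push_cast
    gcongr

lemma ringKrullDim_quotient_le_zero_of_radical_eq {R : Type*} [CommRing R] [IsLocalRing R]
    {I : Ideal R} (hI : I.radical = maximalIdeal R) : ringKrullDim (R ⧸ I) ≤ 0 := by
  rw [← Nat.cast_zero, ← Ring.krullDimLE_iff, Ring.krullDimLE_zero_iff]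
  intro p hp
  have hle : maximalIdeal R ≤ p.comap (Ideal.Quotient.mk I) := by
    rw [← hI, (hp.comap (Ideal.Quotient.mk I)).radical_le_iff]
    intro r hr
    rw [Ideal.mem_comap, Ideal.Quotient.eq_zero_iff_mem.2 hr]
    exact p.zero_mem
  have hmax : (p.comap (Ideal.Quotient.mk I)).IsMaximal := by
    rw [← (maximalIdeal.isMaximal R).eq_of_le (hp.comap _).ne_top hle]
    exact maximalIdeal.isMaximal R
  rw [← Ideal.map_comap_of_surjective _ Ideal.Quotient.mk_surjective p]
  exact
    (Ideal.map_eq_top_or_isMaximal_of_surjective _ Ideal.Quotient.mk_surjective hmax).resolve_left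
    (by rw [Ideal.map_comap_of_surjective _ Ideal.Quotient.mk_surjective]; exact hp.ne_top)

/-- An element of a system of parameters is regular on a module of maximal depth relative to the
parameters that annihilate it. -/
lemma HomExactBelow.isSMulRegular {R : Type} [CommRing R] [IsNoetherianRing R]
    [IsLocalRing R] (P : ProjectiveResolution (ModuleCat.of R (R ⧸ maximalIdeal R)))
    {ι : Type*} [Fintype ι] [DecidableEq ι] {x : ι → R}
    (hsop : (Ideal.span (Set.range x)).radical = maximalIdeal R) {n : ℕ}
    {N : Type} [AddCommGroup N] [Module R N] [Module.Finite R N]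
    (h : HomExactBelow P.complex (ModuleCat.of R N) n) (T : Finset ι)
    (hT : ∀ i ∈ T, ∀ z : N, x i • z = 0) (hn : Fintype.card ι ≤ n + T.card) {j : ι}
    (hj : j ∉ T) : IsSMulRegular N (x j) := by
  classical
  by_contra hreg
  obtain ⟨z, hz, hz0⟩ : ∃ z : N, x j • z = 0 ∧ z ≠ 0 := by
    rw [isSMulRegular_iff_right_eq_zero_of_smul] at hreg
    push Not at hreg
    exact hreg
  obtain ⟨p, hp, hle⟩ := exists_le_isAssociatedPrime_of_isNoetherianRing R z hz0
  have hxm : ∀ i, x i ∈ maximalIdeal R := fun i => hsop ▸ Ideal.le_radical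
    (Ideal.subset_span ⟨i, rfl⟩)
  have := hp.isPrime
  have hxp : ∀ i ∈ insert j T, x i ∈ p := by
    intro i hi
    refine hle ?_
    rw [Submodule.mem_colon_singleton, Submodule.mem_bot]
    rcases Finset.mem_insert.1 hi with rfl | hi
    exacts [hz, hT i hi z]
  let s : Finset (R ⧸ p) := (insert j T)ᶜ.image fun i => Ideal.Quotient.mk p (x i)
  have hcard : s.card + 1 ≤ n := by
    have h₁ : s.card ≤ (insert j T)ᶜ.card := Finset.card_image_le
    have h₂ := Finset.card_add_card_compl (insert j T)
    rw [Finset.card_insert_of_notMem hj] at h₂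
    omega
  have hlow := h.le_ringKrullDim_quotient P hp
  have hzero : ringKrullDim ((R ⧸ p) ⧸ Ideal.span (s : Set (R ⧸ p))) ≤ 0 := by
    refine le_trans ?_ (ringKrullDim_quotient_le_zero_of_radical_eq hsop)
    let φ : R →+* (R ⧸ p) ⧸ Ideal.span (s : Set (R ⧸ p)) :=
      (Ideal.Quotient.mk _).comp (Ideal.Quotient.mk p)
    have hφ : Function.Surjective φ :=
      Ideal.Quotient.mk_surjective.comp Ideal.Quotient.mk_surjective
    have hker : ∀ r ∈ Ideal.span (Set.range x), φ r = 0 := by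
      change Ideal.span (Set.range x) ≤ RingHom.ker φ
      rw [Ideal.span_le]
      rintro _ ⟨i, rfl⟩
      change Ideal.Quotient.mk _ (Ideal.Quotient.mk p (x i)) = 0
      by_cases hi : i ∈ insert j T
      · rw [Ideal.Quotient.eq_zero_iff_mem.2 (hxp i hi), map_zero]
      · rw [Ideal.Quotient.eq_zero_iff_mem]
        exact Ideal.subset_span (Finset.mem_image.2 ⟨i, Finset.mem_compl.2 hi, rfl⟩)
    exact ringKrullDim_le_of_surjective (Ideal.Quotient.lift _ φ hker)
      (Ideal.Quotient.lift_surjective_of_surjective _ hker hφ)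
  have : IsLocalRing (R ⧸ p) :=
    IsLocalRing.of_surjective' (Ideal.Quotient.mk p) Ideal.Quotient.mk_surjective
  have hup := ringKrullDim_le_ringKrullDim_quotient_add_card s (by
    rw [IsLocalRing.ringJacobson_eq_maximalIdeal]
    intro y hy
    obtain ⟨i, -, rfl⟩ := Finset.mem_image.1 hy
    change Ideal.Quotient.mk p (x i) ∈ maximalIdeal (R ⧸ p)
    rw [mem_maximalIdeal, mem_nonunits_iff]
    intro hu
    have := IsLocalHom.of_surjective (Ideal.Quotient.mk p) Ideal.Quotient.mk_surjective
    exact (mem_nonunits_iff.1 ((mem_maximalIdeal _).1 (hxm i))) (isUnit_of_map_unit _ _ hu))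
  have hlt : (n : WithBot ℕ∞) ≤ s.card := by
    refine hlow.trans (hup.trans ?_)
    calc _ ≤ (0 : WithBot ℕ∞) + s.card := by gcongr
      _ = s.card := zero_add _
  have : n ≤ s.card := by exact_mod_cast hlt
  omega

/-! ### Syzygies -/

lemma IsSyzygyCat.of_linearEquiv {R : Type} [CommRing R] {k : ℕ} {K : ModuleCat.{0} R}
    {N N' : Type} [AddCommGroup N] [Module R N] [AddCommGroup N'] [Module R N']
    (h : IsSyzygyCat R k K (ModuleCat.of R N)) (e : N ≃ₗ[R] N') :
    IsSyzygyCat R k K (ModuleCat.of R N') := by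
  cases k with
  | zero =>
    obtain ⟨e'⟩ := h
    exact ⟨e'.trans e⟩
  | succ k =>
    obtain ⟨s, p, hp, hK⟩ := h
    refine ⟨s, e.toLinearMap ∘ₗ p, e.surjective.comp hp, ?_⟩
    have hker : LinearMap.ker (e.toLinearMap ∘ₗ p) = LinearMap.ker p := by simp
    rw [hker]
    exact hK

lemma IsSyzygyCat.succ_of_surjective {R : Type} [CommRing R] {k : ℕ} {K : ModuleCat.{0} R}
    {F N : Type} [AddCommGroup F] [Module R F] [AddCommGroup N] [Module R N] {s : ℕ}
    (e : (Fin s → R) ≃ₗ[R] F) (p : F →ₗ[R] N) (hp : Function.Surjective p)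
    (h : IsSyzygyCat R k K (ModuleCat.of R (LinearMap.ker p))) :
    IsSyzygyCat R (k + 1) K (ModuleCat.of R N) := by
  refine ⟨s, p ∘ₗ e.toLinearMap, hp.comp e.surjective, h.of_linearEquiv ?_⟩
  have hker : LinearMap.ker (p ∘ₗ e.toLinearMap) = (LinearMap.ker p).comap e.toLinearMap :=
    LinearMap.ker_comp _ _
  rw [hker]
  exact (LinearEquiv.ofSubmodule' e (LinearMap.ker p)).symm

lemma IsSyzygyCat.finite {R : Type} [CommRing R] [IsNoetherianRing R] {k : ℕ}
    {K : ModuleCat.{0} R} {N : Type} [AddCommGroup N] [Module R N] [Module.Finite R N]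
    (h : IsSyzygyCat R k K (ModuleCat.of R N)) : Module.Finite R K := by
  induction k generalizing N with
  | zero =>
    obtain ⟨e⟩ := h
    exact Module.Finite.equiv (e.symm : N ≃ₗ[R] K)
  | succ k ih =>
    obtain ⟨s, p, hp, hK⟩ := h
    exact ih hK

lemma StablyAnn.exists_lift {R : Type} [CommRing R] {K F : Type} [AddCommGroup K] [Module R K]
    [AddCommGroup F] [Module R F] {y : R} (h : StablyAnn R K y) {π : F →ₗ[R] K}
    (hπ : Function.Surjective π) : ∃ t : K →ₗ[R] F, ∀ a, π (t a) = y • a := by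
  obtain ⟨P, _, _, _, _, f, g, hgf⟩ := h
  obtain ⟨l, hl⟩ := Module.projective_lifting_property π g hπ
  refine ⟨l ∘ₗ f, fun a => ?_⟩
  have h₁ := LinearMap.congr_fun hl (f a)
  have h₂ := LinearMap.congr_fun hgf a
  simp only [LinearMap.comp_apply] at h₁ h₂ ⊢
  rw [h₁, h₂]
  simp

lemma StablyAnn.prod {R : Type} [CommRing R] {K L : Type} [AddCommGroup K] [Module R K]
    [AddCommGroup L] [Module R L] {y : R} (hK : StablyAnn R K y) (hL : StablyAnn R L y) :
    StablyAnn R (K × L) y := by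
  obtain ⟨P, _, _, _, _, f, g, hgf⟩ := hK
  obtain ⟨Q, _, _, _, _, f', g', hgf'⟩ := hL
  refine ⟨P × Q, inferInstance, inferInstance, inferInstance, inferInstance, f.prodMap f',
    g.prodMap g', ?_⟩
  rw [LinearMap.prodMap_comp, hgf, hgf']
  ext <;> simp

lemma StablyAnn.ker {R : Type} [CommRing R] {K F : Type} [AddCommGroup K] [Module R K]
    [AddCommGroup F] [Module R F] [Module.Finite R F] [Module.Projective R F] {y : R}
    (h : StablyAnn R K y) {π : F →ₗ[R] K} (hπ : Function.Surjective π) :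
    StablyAnn R (LinearMap.ker π) y := by
  obtain ⟨t, ht⟩ := h.exists_lift hπ
  refine ⟨F, inferInstance, inferInstance, inferInstance, inferInstance,
    (LinearMap.ker π).subtype,
    (y • LinearMap.id - t ∘ₗ π).codRestrict (LinearMap.ker π) fun v => ?_, ?_⟩
  · ext ⟨v, hv⟩
    simp [LinearMap.mem_ker.1 hv]
  · simp [ht]

/-- If `y` is regular on `N` and stably annihilates `N`, the pullback of a free cover of `N` along
multiplication by `y` splits. -/
lemma nonempty_prod_ker_linearEquiv {R : Type} [CommRing R] {K N N' F : Type} [AddCommGroup K]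
    [Module R K] [AddCommGroup N] [Module R N] [AddCommGroup N'] [Module R N'] [AddCommGroup F]
    [Module R F] {y : R} {q : N →ₗ[R] N'} (hq : IsQuotBy y q) (hN : IsSMulRegular N y)
    (e : K ≃ₗ[R] N) (h : StablyAnn R K y) {π : F →ₗ[R] K} (hπ : Function.Surjective π) :
    Nonempty ((K × LinearMap.ker π) ≃ₗ[R] LinearMap.ker (q ∘ₗ e.toLinearMap ∘ₗ π)) := by
  obtain ⟨t, ht⟩ := h.exists_lift hπ
  let φ : (K × LinearMap.ker π) →ₗ[R] LinearMap.ker (q ∘ₗ e.toLinearMap ∘ₗ π) :=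
    (t.coprod (LinearMap.ker π).subtype).codRestrict _ (by
      rintro ⟨a, z, hz⟩
      rw [LinearMap.mem_ker] at hz
      simp only [LinearMap.mem_ker, LinearMap.comp_apply, LinearMap.coprod_apply,
        Submodule.subtype_apply, map_add, hz, ht, map_zero, add_zero]
      exact (hq.map_eq_zero_iff _).2 ⟨e a, by simp⟩)
  refine ⟨LinearEquiv.ofBijective φ ⟨?_, ?_⟩⟩
  · rw [injective_iff_map_eq_zero]
    rintro ⟨a, z, hz⟩ haz
    have haz' : t a + z = 0 := congrArg Subtype.val haz
    have hya : y • a = 0 := by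
      have := congrArg π haz'
      rwa [map_add, ht, LinearMap.mem_ker.1 hz, add_zero, map_zero] at this
    have hea : e a = 0 := by
      refine hN ?_
      change y • e a = y • (0 : N)
      rw [← map_smul, hya, map_zero, smul_zero]
    have ha : a = 0 := by simpa using hea
    subst ha
    have hz0 : z = 0 := by simpa using haz'
    subst hz0
    rfl
  · rintro ⟨v, hv⟩
    obtain ⟨m, hm⟩ := (hq.map_eq_zero_iff _).1 (LinearMap.mem_ker.1 hv)
    have hπv : π v = y • e.symm m := by
      rw [← map_smul, hm]
      simp
    refine ⟨(e.symm m, ⟨v - t (e.symm m), ?_⟩), ?_⟩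
    · simp [ht, hπv]
    · ext1
      change t (e.symm m) + (v - t (e.symm m)) = v
      abel

/-- Let `p` be a cover of `N` by `F` with kernel `N₁`, and `L` the kernel of the induced cover of
`N / y N`. A cover `p₁` of `N₁ / y N₁` by a projective `G` yields a cover of `L` by `G × F` with the
same kernel as `p₁`. -/
lemma exists_cover_of_quotient_ker {R : Type} [CommRing R] {N N' F G L' : Type} [AddCommGroup N]
    [Module R N] [AddCommGroup N'] [Module R N'] [AddCommGroup F] [Module R F] [AddCommGroup G]
    [Module R G] [Module.Projective R G] [AddCommGroup L'] [Module R L'] {y : R}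
    {q : N →ₗ[R] N'} (hq : IsQuotBy y q) (hF : IsSMulRegular F y) (hN : IsSMulRegular N y)
    {p : F →ₗ[R] N} (hp : Function.Surjective p) {q₁ : LinearMap.ker p →ₗ[R] L'}
    (hq₁ : IsQuotBy y q₁) {p₁ : G →ₗ[R] L'} (hp₁ : Function.Surjective p₁) :
    ∃ r : (G × F) →ₗ[R] LinearMap.ker (q ∘ₗ p), Function.Surjective r ∧
      Nonempty (LinearMap.ker p₁ ≃ₗ[R] LinearMap.ker r) := by
  obtain ⟨l, hl⟩ := Module.projective_lifting_property q₁ p₁ hq₁.surjective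
  have hl' : ∀ g, q₁ (l g) = p₁ g := fun g => LinearMap.congr_fun hl g
  have hpl : ∀ g, p (l g) = 0 := fun g => (l g).2
  let r : (G × F) →ₗ[R] LinearMap.ker (q ∘ₗ p) :=
    (((LinearMap.ker p).subtype ∘ₗ l).coprod (LinearMap.lsmul R F y)).codRestrict _ (by
      rintro ⟨g, v⟩
      simp only [LinearMap.mem_ker, LinearMap.comp_apply, LinearMap.coprod_apply,
        Submodule.subtype_apply, map_add, hpl, map_zero, zero_add, LinearMap.lsmul_apply]
      exact (hq.map_eq_zero_iff _).2 ⟨p v, by simp⟩)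
  have hr : ∀ g v, (r (g, v) : F) = l g + y • v := fun _ _ => rfl
  have hmem : ∀ x : G × F, r x = 0 → p x.2 = 0 := by
    rintro ⟨g, v⟩ h
    have h' := congrArg (fun z => p (Subtype.val z)) h
    simp only [hr, map_add, hpl, zero_add, map_smul, ZeroMemClass.coe_zero, map_zero] at h'
    exact hN (h'.trans (smul_zero y).symm)
  refine ⟨r, ?_, ?_⟩
  · rintro ⟨w, hw⟩
    obtain ⟨n, hn⟩ := (hq.map_eq_zero_iff _).1 (LinearMap.mem_ker.1 hw)
    obtain ⟨v, rfl⟩ := hp n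
    let u : LinearMap.ker p := ⟨w - y • v, by simp [hn]⟩
    obtain ⟨g, hg⟩ := hp₁ (q₁ u)
    obtain ⟨z, hz⟩ := (hq₁.map_eq_zero_iff (u - l g)).1 (by rw [map_sub, hl', hg, sub_self])
    refine ⟨(g, v + z), ?_⟩
    ext1
    have hz' : y • (z : F) = w - y • v - l g := congrArg Subtype.val hz
    rw [hr, smul_add, hz']
    abel
  · let ψ : LinearMap.ker r →ₗ[R] LinearMap.ker p₁ :=
      (LinearMap.fst R G F ∘ₗ (LinearMap.ker r).subtype).codRestrict _ (by
        rintro ⟨⟨g, v⟩, h⟩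
        rw [LinearMap.mem_ker] at h
        change p₁ g = 0
        rw [← hl', hq₁.map_eq_zero_iff]
        refine ⟨-⟨v, hmem _ h⟩, ?_⟩
        ext1
        have h' : (l g : F) + y • v = 0 := congrArg Subtype.val h
        simpa using (eq_neg_of_add_eq_zero_left h').symm)
    refine ⟨(LinearEquiv.ofBijective ψ ⟨?_, ?_⟩).symm⟩
    · rw [injective_iff_map_eq_zero]
      rintro ⟨⟨g, v⟩, h⟩ hg
      have hg0 : g = 0 := congrArg Subtype.val hg
      subst hg0
      have h' : ((l 0 : LinearMap.ker p) : F) + y • v = 0 := congrArg Subtype.val h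
      have hv : v = 0 := hF (by simpa using h')
      subst hv
      rfl
    · rintro ⟨g, hg⟩
      obtain ⟨w, hw⟩ := (hq₁.map_eq_zero_iff (l g)).1 (by rw [hl']; exact hg)
      refine ⟨⟨(g, -w), ?_⟩, rfl⟩
      rw [LinearMap.mem_ker]
      ext1
      have hw' : y • (w : F) = l g := congrArg Subtype.val hw
      rw [hr, smul_neg, hw']
      simp

/-- If `y` stably annihilates the `k`-th syzygy `K` of `N`, then `K ⊕ Ω K` is a `(k+1)`-st syzygy
of `N / y N`. -/
lemma IsSyzygyCat.prod_ker {R : Type} [CommRing R] {k : ℕ} {K : ModuleCat.{0} R} {N N' : Type}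
    [AddCommGroup N] [Module R N] [AddCommGroup N'] [Module R N'] {y : R} {q : N →ₗ[R] N'}
    (hK : IsSyzygyCat R k K (ModuleCat.of R N)) (hq : IsQuotBy y q) (hR : IsSMulRegular R y)
    (hN : IsSMulRegular N y) (h : StablyAnn R K y) {s : ℕ} {π : (Fin s → R) →ₗ[R] K}
    (hπ : Function.Surjective π) :
    IsSyzygyCat R (k + 1) (ModuleCat.of R (K × LinearMap.ker π)) (ModuleCat.of R N') := by
  induction k generalizing N N' with
  | zero =>
    obtain ⟨e⟩ := hK
    exact ⟨s, q ∘ₗ e.toLinearMap ∘ₗ π, hq.surjective.comp (e.surjective.comp hπ),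
      nonempty_prod_ker_linearEquiv hq hN e h hπ⟩
  | succ k ih =>
    obtain ⟨s₀, p, hp, hK⟩ := hK
    have hF : IsSMulRegular (Fin s₀ → R) y := IsSMulRegular.pi fun _ => hR
    have hN₁ : IsSMulRegular (LinearMap.ker p) y :=
      hF.of_injective (LinearMap.ker p).subtype Subtype.val_injective
    obtain ⟨s₁, p₁, hp₁, hK₁⟩ := ih hK (isQuotBy_mkQ y) hN₁
    obtain ⟨r, hr, ⟨e⟩⟩ := exists_cover_of_quotient_ker hq hF hN hp (isQuotBy_mkQ y) hp₁
    exact ⟨s₀, q ∘ₗ p, hq.surjective.comp hp, IsSyzygyCat.succ_of_surjective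
      ((LinearEquiv.funCongrLeft R R finSumFinEquiv).trans
        (LinearEquiv.sumArrowLequivProdArrow (Fin s₁) (Fin s₀) R R)) r hr
      (hK₁.of_linearEquiv e)⟩

/-- Iterating over the parameters, `M` is a summand of a `k`-th syzygy of the quotient of `M` by the
first `k` parameters. -/
lemma exists_isSyzygyCat_quotient_span {R : Type} [CommRing R] [IsNoetherianRing R] [IsLocalRing R]
    (P : ProjectiveResolution (ModuleCat.of R (R ⧸ maximalIdeal R))) {d : ℕ}
    (hR : HomExactBelow P.complex (ModuleCat.of R R) d)
    {M : Type} [AddCommGroup M] [Module R M] [Module.Finite R M]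
    (hM : HomExactBelow P.complex (ModuleCat.of R M) d)
    {x : Fin d → R} (hsop : (Ideal.span (Set.range x)).radical = maximalIdeal R)
    (hann : ∀ i, StablyAnn R M (x i)) {k : ℕ} (hk : k ≤ d) :
    HomExactBelow P.complex (ModuleCat.of R
      (M ⧸ (Ideal.span (Set.image x {i | i.val < k}) • (⊤ : Submodule R M)))) (d - k) ∧
    ∃ K : ModuleCat.{0} R,
      IsSyzygyCat R k K (ModuleCat.of R
        (M ⧸ (Ideal.span (Set.image x {i | i.val < k}) • (⊤ : Submodule R M)))) ∧
      IsSummand R (ModuleCat.of R M) K ∧ ∀ i, StablyAnn R K (x i) := by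
  induction k with
  | zero =>
    let e : M ≃ₗ[R] M ⧸ (Ideal.span (Set.image x {i | i.val < 0}) • (⊤ : Submodule R M)) :=
      (Submodule.quotEquivOfEqBot _ (by simp)).symm
    refine ⟨?_, ModuleCat.of R M, ⟨e⟩, ⟨LinearMap.id, LinearMap.id, rfl⟩, hann⟩
    exact hM.of_iso e.toModuleIso
  | succ k ih =>
    obtain ⟨hdepth, K, hK, ⟨i, p, hip⟩, hKann⟩ := ih (by omega)
    let j : Fin d := ⟨k, hk⟩
    have hideal : Ideal.span (Set.image x {i | i.val < k + 1}) =
        Ideal.span (Set.image x {i | i.val < k}) ⊔ Ideal.span {x j} := by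
      rw [← Ideal.span_union, ← Set.image_singleton, ← Set.image_union]
      congr 2
      ext i
      simp [j, Fin.ext_iff, Nat.le_iff_lt_or_eq, or_comm]
    rw [hideal]
    have hq := isQuotBy_factor_sup (M := M) (Ideal.span (Set.image x {i | i.val < k})) (x j)
    have hxR : IsSMulRegular R (x j) :=
      hR.isSMulRegular P hsop ∅ (by simp) (by simp) (Finset.notMem_empty j)
    have hxN : IsSMulRegular
        (M ⧸ (Ideal.span (Set.image x {i | i.val < k}) • (⊤ : Submodule R M))) (x j) := by
      refine hdepth.isSMulRegular P hsop (Finset.univ.filter fun i => i.val < k) ?_ ?_ (by simp [j])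
      · intro i hi z
        obtain ⟨z, rfl⟩ := Submodule.mkQ_surjective _ z
        rw [← map_smul, Submodule.mkQ_apply, Submodule.Quotient.mk_eq_zero]
        exact Submodule.smul_mem_smul
          (Ideal.subset_span ⟨i, by simpa using hi, rfl⟩) trivial
      · rw [Fintype.card_fin, Fin.card_filter_val_lt]
        omega
    have hfin : Module.Finite R K := hK.finite
    obtain ⟨s, π, hπ⟩ := Module.Finite.exists_fin' R K
    have hd : d - k = d - (k + 1) + 1 := by omega
    refine ⟨HomExactBelow.of_isQuotBy hq hxN (hd ▸ hdepth), _,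
      hK.prod_ker hq hxR hxN (hKann j) hπ, ⟨LinearMap.inl R K _ ∘ₗ i, p ∘ₗ LinearMap.fst R K _, ?_⟩,
      fun i => (hKann i).prod ((hKann i).ker hπ)⟩
    rw [← hip]
    ext
    simp

end

open IsLocalRing in
/-- Over a CM local ring of dimension d, a maximal Cohen-Macaulay module whose stable
annihilator contains a system of parameters x is a direct summand of the d-th syzygy of
M/xM. Depth conditions are expressed via vanishing of Ext against the residue field. -/
theorem summand_of_syzygy_of_quotient (R : Type) [CommRing R] [IsNoetherianRing R] [IsLocalRing R]
    (d : ℕ) (hdim : ringKrullDim R = d)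
    (hCMring : ∀ i < d,
      Subsingleton (ExtMod R i (ModuleCat.of R (R ⧸ maximalIdeal R)) (ModuleCat.of R R)))
    (M : Type) [AddCommGroup M] [Module R M] [Module.Finite R M]
    (hMCM : ∀ i < d,
      Subsingleton (ExtMod R i (ModuleCat.of R (R ⧸ maximalIdeal R)) (ModuleCat.of R M)))
    (x : Fin d → R) (hsop : (Ideal.span (Set.range x)).radical = maximalIdeal R)
    (hann : ∀ i, StablyAnn R M (x i)) :
    ∃ K : ModuleCat.{0} R,
      IsSyzygyCat R d K
        (ModuleCat.of R (M ⧸ (Ideal.span (Set.range x) • (⊤ : Submodule R M)))) ∧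
      ∃ (i : M →ₗ[R] K) (p : K →ₗ[R] M), p ∘ₗ i = LinearMap.id := by
  let P := CategoryTheory.projectiveResolution (ModuleCat.of R (R ⧸ maximalIdeal R))
  obtain ⟨-, K, hK, hsummand, -⟩ := exists_isSyzygyCat_quotient_span P
    (homExactBelow_of_subsingleton_extMod P hCMring)
    (homExactBelow_of_subsingleton_extMod P hMCM) hsop hann le_rfl
  have hrange : Set.image x {i | i.val < d} = Set.range x := by
    rw [← Set.image_univ]
    congr 1
    ext i
    simp
  rw [hrange] at hK
  exact ⟨K, hK, hsummand⟩
end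

section
/- Let (R, m, k) be a noetherian local ring of depth t, and suppose the maximal ideal m is contained in ca^{t+1}(R), i.e., m annihilates Ext_R^i(M, N) for all i ≥ t+1 and all finitely generated R-modules M, N. Then R has an isolated singularity: R_p is regular for every prime ideal p ≠ m. -/
open IsLocalRing

section

open CategoryTheory Limits

universe u

section FinitelyGeneratedResolutions

variable {R : Type u} [CommRing R] [IsNoetherianRing R]

instance FGModuleCat.enoughProjectives : EnoughProjectives (FGModuleCat.{u} R) where
  presentation X := by
    obtain ⟨n, f, hf⟩ := Module.Finite.exists_fin' R X
    have : Projective (FGModuleCat.of R (Fin n → R)) := by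
      constructor
      intro E Y g e he
      have he' : Function.Surjective e.hom.hom := by
        rw [← ModuleCat.epi_iff_surjective]
        exact inferInstanceAs (Epi ((forget₂ (FGModuleCat.{u} R) (ModuleCat.{u} R)).map e))
      obtain ⟨h, hh⟩ := Module.projective_lifting_property e.hom.hom g.hom.hom he'
      refine ⟨FGModuleCat.ofHom h, ?_⟩
      exact FGModuleCat.hom_ext hh
    refine ⟨{ p := FGModuleCat.of R (Fin n → R), f := FGModuleCat.ofHom f, epi := ?_ }⟩
    apply (forget₂ (FGModuleCat.{u} R) (ModuleCat.{u} R)).epi_of_epi_map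
    exact (ModuleCat.epi_iff_surjective _).mpr hf

instance FGModuleCat.forget₂_preservesProjectiveObjects :
    (forget₂ (FGModuleCat.{u} R) (ModuleCat.{u} R)).PreservesProjectiveObjects where
  projective_obj {X} hX := by
    obtain ⟨n, f, hf⟩ := Module.Finite.exists_fin' R X
    let f' : FGModuleCat.of R (Fin n → R) ⟶ X := FGModuleCat.ofHom f
    have : Epi f' := by
      apply (forget₂ (FGModuleCat.{u} R) (ModuleCat.{u} R)).epi_of_epi_map
      exact (ModuleCat.epi_iff_surjective _).mpr hf
    let r : Retract ((forget₂ (FGModuleCat.{u} R) (ModuleCat.{u} R)).obj X)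
        (ModuleCat.of R (Fin n → R)) :=
      { i := (forget₂ (FGModuleCat.{u} R) (ModuleCat.{u} R)).map (Projective.factorThru (𝟙 X) f')
        r := (forget₂ (FGModuleCat.{u} R) (ModuleCat.{u} R)).map f'
        retract := by
          rw [← Functor.map_comp, Projective.factorThru_comp, CategoryTheory.Functor.map_id] }
    have : Projective (ModuleCat.of R (Fin n → R)) := by
      rw [← IsProjective.iff_projective]
      exact inferInstanceAs (Module.Projective R (Fin n → R))
    exact r.projective

/-- Over a noetherian ring, a finitely generated module has a projective resolution by finitely
generated modules. -/
theorem ModuleCat.exists_projectiveResolution_finite (M : ModuleCat.{u} R) [Module.Finite R M] :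
    ∃ P : ProjectiveResolution M, ∀ n, Module.Finite R (P.complex.X n) :=
  ⟨(forget₂ (FGModuleCat.{u} R) (ModuleCat.{u} R)).mapProjectiveResolution
    (ProjectiveResolution.of (FGModuleCat.of R M)), fun n ↦
    inferInstanceAs (Module.Finite R ((ProjectiveResolution.of (FGModuleCat.of R M)).complex.X n))⟩

end FinitelyGeneratedResolutions

theorem CategoryTheory.ShortComplex.exists_f_eq_smul_of_smul_homology_eq_zero {R : Type*}
    [CommRing R] (S : ShortComplex (ModuleCat R)) (a : R) (ha : ∀ x : S.homology, a • x = 0)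
    (x : S.X₂) (hx : S.g x = 0) : ∃ y, S.f y = a • x := by
  let c : LinearMap.ker S.g.hom := ⟨x, hx⟩
  have h : a • (Submodule.Quotient.mk c : _ ⧸ LinearMap.range S.moduleCatToCycles) = 0 := by
    apply S.moduleCatHomologyIso.toLinearEquiv.symm.injective
    exact (LinearEquiv.map_smul _ a _).trans ((ha _).trans (map_zero _).symm)
  rw [← Submodule.Quotient.mk_smul, Submodule.Quotient.mk_eq_zero] at h
  obtain ⟨y, hy⟩ := h
  exact ⟨y, congrArg Subtype.val hy⟩

/-- If `a` annihilates `Ext^(n+1)(M, N)`, computed from a resolution `P`, then `a` times any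
cocycle `P_{n+1} ⟶ N` is a coboundary. -/
theorem exists_d_comp_eq_smul {R : Type} [CommRing R] {M : ModuleCat.{0} R}
    (P : ProjectiveResolution M) {n : ℕ} {N : ModuleCat.{0} R} (a : R)
    (ha : ∀ x : ExtMod R (n + 1) M N, a • x = 0)
    (f : P.complex.X (n + 1) ⟶ N) (hf : P.complex.d (n + 2) (n + 1) ≫ f = 0) :
    ∃ h : P.complex.X n ⟶ N, P.complex.d (n + 1) n ≫ h = a • f := by
  let K := P.complex.linearYonedaObj R N
  obtain ⟨h, hh⟩ := (K.sc' n (n + 1) (n + 2)).exists_f_eq_smul_of_smul_homology_eq_zero a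
    (fun x ↦ by
      let e := (P.isoExt (R := R) (n + 1) N ≪≫ ShortComplex.homologyMapIso
        (K.isoSc' n (n + 1) (n + 2) (by simp) (by simp))).toLinearEquiv
      apply e.symm.injective
      rw [map_smul, map_zero]
      exact ha _) f hf
  exact ⟨h, hh⟩

theorem ModuleCat.localizedModuleMap_smul {R : Type*} [CommRing R] {M N : ModuleCat R}
    (S : Submonoid R) (a : R) (f : M ⟶ N) :
    localizedModuleMap S (a • f) = algebraMap R (Localization S) a • localizedModuleMap S f := by
  ext x
  obtain ⟨⟨y, s⟩, rfl⟩ := IsLocalizedModule.mk'_surjective S (M.localizedModuleMkLinearMap S) x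
  simp

/-- If an element of `S` annihilates `Ext^i_R(M, N)` for all `i > n` and all finitely generated `N`,
then `S⁻¹M` has projective dimension at most `n`. -/
theorem hasProjectiveDimensionLT_localizedModule {R : Type} [CommRing R] [IsNoetherianRing R]
    (S : Submonoid R) (M : ModuleCat.{0} R) [Module.Finite R M] (n : ℕ) (a : R) (ha : a ∈ S)
    (h : ∀ i ≥ n + 1, ∀ N : ModuleCat.{0} R, Module.Finite R N →
      ∀ x : ExtMod R i M N, a • x = 0) :
    HasProjectiveDimensionLT (M.localizedModule S) (n + 1) := by
  obtain ⟨P, hP⟩ := M.exists_projectiveResolution_finite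
  let F := ModuleCat.localizedModuleFunctor.{0} S
  let Q : ProjectiveResolution (F.obj M) := F.mapProjectiveResolution P
  change HasProjectiveDimensionLT (F.obj M) (n + 1)
  rw [hasProjectiveDimensionLT_iff]
  intro i hi Y e
  obtain ⟨i, rfl⟩ : ∃ j, i = j + 1 := ⟨i - 1, by omega⟩
  obtain ⟨f, hf, rfl⟩ := Q.extMk_surjective e (i + 2) rfl
  rw [Q.extMk_eq_zero_iff f _ _ _ i rfl]
  let T : ShortComplex (ModuleCat R) := ShortComplex.mk (P.complex.d (i + 2) (i + 1))
    (cokernel.π (P.complex.d (i + 2) (i + 1))) (by simp)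
  have hT : T.Exact := ShortComplex.exact_cokernel _
  have hN : Module.Finite R ↑(cokernel (P.complex.d (i + 2) (i + 1))) :=
    Module.Finite.of_surjective (cokernel.π (P.complex.d (i + 2) (i + 1))).hom
      ((ModuleCat.epi_iff_surjective _).mp inferInstance)
  obtain ⟨g, hg⟩ := exists_d_comp_eq_smul P a (h (i + 1) hi _ hN)
    (cokernel.π (P.complex.d (i + 2) (i + 1))) (by simp)
  have hTF : (T.map F).Exact := ModuleCat.localizedModuleFunctor_map_exact S T hT
  have : Epi (T.map F).g := by
    change Epi (F.map (cokernel.π (P.complex.d (i + 2) (i + 1))))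
    infer_instance
  obtain ⟨v, hv⟩ : ∃ v : F.obj (cokernel (P.complex.d (i + 2) (i + 1))) ⟶ Y,
      F.map (cokernel.π (P.complex.d (i + 2) (i + 1))) ≫ v = f :=
    ⟨hTF.desc f hf, hTF.g_desc f hf⟩
  obtain ⟨u, hu⟩ := IsLocalization.map_units (Localization S) ⟨a, ha⟩
  have key : F.map (P.complex.d (i + 1) i) ≫ F.map g =
      (u : Localization S) • F.map (cokernel.π (P.complex.d (i + 2) (i + 1))) := by
    rw [← F.map_comp, hg, hu]
    exact ModuleCat.localizedModuleMap_smul S a _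
  refine ⟨((u⁻¹ : (Localization S)ˣ) : Localization S) • F.map g ≫ v, ?_⟩
  change F.map (P.complex.d (i + 1) i) ≫ _ = f
  rw [Linear.comp_smul, ← Category.assoc, key, Linear.smul_comp, smul_smul, Units.inv_mul,
    one_smul]
  exact hv

/-- Any localization of a module agrees with `ModuleCat.localizedModule`. -/
noncomputable def ModuleCat.localizedModuleIso {R : Type*} [CommRing R] (M : ModuleCat R)
    (S : Submonoid R) {N : Type _} [AddCommGroup N] [Module R N] [Module (Localization S) N]
    [IsScalarTower R (Localization S) N] (g : M →ₗ[R] N) [IsLocalizedModule S g] :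
    M.localizedModule S ≅ ModuleCat.of (Localization S) N :=
  ((IsLocalizedModule.linearEquiv S (M.localizedModuleMkLinearMap S) g).extendScalarsOfIsLocalization
    S (Localization S)).toModuleIso

theorem hasProjectiveDimensionLT_residueField_localization {R : Type} [CommRing R]
    [IsNoetherianRing R] (p : Ideal R) [p.IsPrime] (n : ℕ) (a : R) (ha : a ∉ p)
    (h : ∀ i ≥ n + 1, ∀ N : ModuleCat.{0} R, Module.Finite R N →
      ∀ x : ExtMod R i (ModuleCat.of R (R ⧸ p)) N, a • x = 0) :
    HasProjectiveDimensionLT (ModuleCat.of (Localization.AtPrime p)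
      (Localization.AtPrime p ⧸ IsLocalRing.maximalIdeal (Localization.AtPrime p))) (n + 1) := by
  have := hasProjectiveDimensionLT_localizedModule p.primeCompl (ModuleCat.of R (R ⧸ p)) n a ha h
  have hI : (p.localized' (Localization.AtPrime p) p.primeCompl
      (Algebra.linearMap R (Localization.AtPrime p))) =
      IsLocalRing.maximalIdeal (Localization.AtPrime p) := by
    rw [Ideal.localized'_eq_map, Localization.AtPrime.map_eq_maximalIdeal]
  let g := p.toLocalizedQuotient' (Localization.AtPrime p) p.primeCompl
      (Algebra.linearMap R (Localization.AtPrime p))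
  let e := ((ModuleCat.of R (R ⧸ p)).localizedModuleIso p.primeCompl g) ≪≫
    (Submodule.quotEquivOfEq _ _ hI).toModuleIso
  exact hasProjectiveDimensionLT_of_iso e (n + 1)

section Regular

variable {R : Type u} [CommRing R]

theorem hasProjectiveDimensionLT_one_iff_moduleProjective (M : Type u) [AddCommGroup M]
    [Module R M] :
    HasProjectiveDimensionLT (ModuleCat.of R M) 1 ↔ Module.Projective R M := by
  rw [IsProjective.iff_projective, projective_iff_hasProjectiveDimensionLT_one]

theorem hasProjectiveDimensionLT_zero_iff_subsingleton (M : Type u) [AddCommGroup M]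
    [Module R M] :
    HasProjectiveDimensionLT (ModuleCat.of R M) 0 ↔ Subsingleton M := by
  rw [hasProjectiveDimensionLT_zero_iff_isZero, ModuleCat.isZero_iff_subsingleton]

theorem hasProjectiveDimensionLT_ker_iff {F M : Type u} [AddCommGroup F] [Module R F]
    [Module.Projective R F] [AddCommGroup M] [Module R M] (f : F →ₗ[R] M)
    (hf : Function.Surjective f) (n : ℕ) :
    HasProjectiveDimensionLT (ModuleCat.of R M) (n + 2) ↔
      HasProjectiveDimensionLT (ModuleCat.of R (LinearMap.ker f)) (n + 1) :=
  (LinearMap.shortExact_shortComplexKer hf).hasProjectiveDimensionLT_X₃_iff n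
    ((IsProjective.iff_projective F).mp inferInstance)

theorem IsLocalRing.exists_surjective_forall_mem_maximalIdeal [IsLocalRing R] (M : Type u)
    [AddCommGroup M] [Module R M] [Module.Finite R M] :
    ∃ (n : ℕ) (f : (Fin n → R) →ₗ[R] M), Function.Surjective f ∧
      ∀ v, f v = 0 → ∀ i, v i ∈ maximalIdeal R := by
  let b := Module.finBasis (ResidueField R) (TensorProduct R (ResidueField R) M)
  choose g hg using fun i ↦ TensorProduct.mk_surjective R M (ResidueField R)
    residue_surjective (b i)
  refine ⟨_, Fintype.linearCombination R g, ?_, fun v hv i ↦ ?_⟩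
  · rw [← LinearMap.range_eq_top, Fintype.range_linearCombination]
    exact span_eq_top_of_tmul_eq_basis g b hg
  · have h : ∑ j, residue R (v j) • b j = 0 := by
      have := congrArg (TensorProduct.mk R (ResidueField R) M 1) hv
      rw [Fintype.linearCombination_apply, map_sum, map_zero] at this
      rw [← this]
      refine Finset.sum_congr rfl fun j _ ↦ ?_
      rw [map_smul, hg]
      rfl
    rw [← residue_eq_zero_iff]
    exact Fintype.linearIndependent_iff.mp b.linearIndependent _ h i

/-- If the socle of a local ring is nonzero, then every finitely generated module of finite
projective dimension is projective. -/
theorem Module.projective_of_hasProjectiveDimensionLT_of_smul_maximalIdeal_eq_zero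
    [IsNoetherianRing R] [IsLocalRing R] {s : R} (hs : s ≠ 0)
    (hsm : ∀ x ∈ maximalIdeal R, s * x = 0) (n : ℕ) :
    ∀ (M : Type u) [AddCommGroup M] [Module R M] [Module.Finite R M],
      HasProjectiveDimensionLT (ModuleCat.of R M) n → Module.Projective R M := by
  induction n with
  | zero =>
    intro M _ _ _ hM
    have := hasProjectiveDimensionLT_of_ge (ModuleCat.of R M) 0 1 zero_le_one
    rwa [← hasProjectiveDimensionLT_one_iff_moduleProjective]
  | succ n ih =>
    intro M _ _ _ hM
    cases n with
    | zero => rwa [← hasProjectiveDimensionLT_one_iff_moduleProjective]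
    | succ n =>
      obtain ⟨k, f, hf, hfm⟩ := exists_surjective_forall_mem_maximalIdeal (R := R) M
      rw [hasProjectiveDimensionLT_ker_iff f hf] at hM
      have := ih _ hM
      have : Module.Free R (LinearMap.ker f) := Module.free_of_flat_of_isLocalRing
      have hker : Subsingleton (LinearMap.ker f) := by
        by_contra hne
        rw [not_subsingleton_iff_nontrivial] at hne
        let b := Module.Free.chooseBasis R (LinearMap.ker f)
        obtain ⟨i⟩ : Nonempty (Module.Free.ChooseBasisIndex R (LinearMap.ker f)) :=
          b.index_nonempty
        have h0 : s • b i = 0 := by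
          ext j
          exact hsm _ (hfm _ (b i).2 j)
        apply hs
        simpa using congrArg (fun v ↦ b.repr v i) h0
      have hinj : Function.Injective f := by
        rw [← LinearMap.ker_eq_bot, ← Submodule.subsingleton_iff_eq_bot]
        exact hker
      exact Module.Projective.of_equiv (LinearEquiv.ofBijective f ⟨hinj, hf⟩)

/-- A noetherian local ring which is not a field and whose residue field has finite projective
dimension has positive depth. -/
theorem IsLocalRing.maximalIdeal_notMem_associatedPrimes
    [IsNoetherianRing R] [IsLocalRing R] (n : ℕ)
    (h : HasProjectiveDimensionLT (ModuleCat.of R (R ⧸ maximalIdeal R)) n)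
    (hm : maximalIdeal R ≠ ⊥) : maximalIdeal R ∉ associatedPrimes R R := by
  intro hass
  obtain ⟨hp, s, hs⟩ := isAssociatedPrime_iff.mp hass
  have hs' : ∀ x ∈ maximalIdeal R, s * x = 0 := fun x hx ↦ by
    rw [hs] at hx
    simpa [mul_comm] using hx
  have hs0 : s ≠ 0 := by
    rintro rfl
    apply hp.ne_top
    rw [hs]
    ext; simp
  have := Module.projective_of_hasProjectiveDimensionLT_of_smul_maximalIdeal_eq_zero hs0 hs' n _ h
  have : Module.Free R (R ⧸ maximalIdeal R) := Module.free_of_flat_of_isLocalRing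
  apply hm
  rw [← Ideal.annihilator_quotient (I := maximalIdeal R)]
  exact Module.annihilator_eq_bot.mpr inferInstance

theorem IsLocalRing.exists_mem_nonZeroDivisors_notMem_sq [IsNoetherianRing R] [IsLocalRing R]
    (hm : maximalIdeal R ≠ ⊥) (h : maximalIdeal R ∉ associatedPrimes R R) :
    ∃ x ∈ maximalIdeal R, x ∈ nonZeroDivisors R ∧ x ∉ maximalIdeal R ^ 2 := by
  by_contra! hc
  have hfin := associatedPrimes.finite R R
  have hsub : (maximalIdeal R : Set R) ⊆
      ⋃ i ∈ ((insert (maximalIdeal R ^ 2) hfin.toFinset : Finset (Ideal R)) : Set (Ideal R)),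
        (i : Set R) := by
    intro x hx
    by_cases hx' : x ∈ nonZeroDivisors R
    · simp only [Set.mem_iUnion]
      exact ⟨_, by simp, hc x hx hx'⟩
    · have : x ∈ ⋃ p ∈ associatedPrimes R R, (p : Set R) := by
        rw [biUnion_associatedPrimes_eq_compl_nonZeroDivisors]
        exact hx'
      simp only [Set.mem_iUnion] at this ⊢
      obtain ⟨p, hp, hxp⟩ := this
      exact ⟨p, by simp [hp], hxp⟩
  obtain ⟨p, hp, hle⟩ := (Ideal.subset_union_prime (f := fun i : Ideal R ↦ i)
    (maximalIdeal R ^ 2) (maximalIdeal R ^ 2) (by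
      intro i hi hi' _
      have : i ∈ associatedPrimes R R := by simpa [hi'] using hi
      exact this.1)).mp hsub
  rw [Finset.mem_insert] at hp
  rcases hp with rfl | hp
  · apply hm
    apply Submodule.eq_bot_of_le_smul_of_le_jacobson_bot (maximalIdeal R) _
      (IsNoetherian.noetherian _) _ (maximalIdeal_le_jacobson _)
    rwa [smul_eq_mul, ← sq]
  · rw [Set.Finite.mem_toFinset] at hp
    exact h ((maximalIdeal.isMaximal R).eq_of_le hp.1.ne_top hle ▸ hp)

/-- Reducing modulo an element `x` which is regular on `R` and on `M` does not increase the
projective dimension. -/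
theorem hasProjectiveDimensionLT_of_ker_eq_smul [IsNoetherianRing R] {R' : Type u} [CommRing R']
    [Algebra R R'] (hR' : Function.Surjective (algebraMap R R')) {x : R}
    (hx : ∀ r : R, algebraMap R R' r = 0 ↔ ∃ c, r = x * c) (hxr : ∀ r : R, x * r = 0 → r = 0)
    (n : ℕ) :
    ∀ (M M' : Type u) [AddCommGroup M] [Module R M] [Module.Finite R M] [AddCommGroup M']
      [Module R M'] [Module R' M'] [IsScalarTower R R' M'] (π : M →ₗ[R] M'),
      Function.Surjective π → (∀ m, π m = 0 ↔ ∃ c, m = x • c) →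
      (∀ m : M, x • m = 0 → m = 0) →
      HasProjectiveDimensionLT (ModuleCat.of R M) n →
      HasProjectiveDimensionLT (ModuleCat.of R' M') n := by
  induction n with
  | zero =>
    intro M M' _ _ _ _ _ _ _ π hπ _ _ h
    rw [hasProjectiveDimensionLT_zero_iff_subsingleton] at h ⊢
    exact hπ.subsingleton
  | succ n ih =>
    intro M M' _ _ _ _ _ _ _ π hπ hπx hxM h
    obtain ⟨k, p, hp⟩ := Module.Finite.exists_fin' R M
    let q : (Fin k → R) →ₗ[R] (Fin k → R') := (Algebra.linearMap R R').compLeft (Fin k)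
    have hq : Function.Surjective q := hR'.comp_left
    have hqx : ∀ v, q v = 0 ↔ ∃ w, v = x • w := fun v ↦ by
      refine ⟨fun hv ↦ ?_, ?_⟩
      · choose w hw using fun i ↦ (hx (v i)).mp (congrFun hv i)
        exact ⟨w, funext hw⟩
      · rintro ⟨w, rfl⟩
        exact funext fun i ↦ (hx _).mpr ⟨w i, rfl⟩
    let p' : (Fin k → R') →ₗ[R'] M' :=
      Fintype.linearCombination R' fun i ↦ π (p (Pi.single i 1))
    have hpq : ∀ v, p' (q v) = π (p v) := fun v ↦ by
      have : v = ∑ i, v i • (Pi.single i 1 : Fin k → R) := by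
        ext j; simp [Finset.sum_apply, Pi.single_apply]
      conv_rhs => rw [this]
      simp only [p', Fintype.linearCombination_apply, map_sum, map_smul]
      refine Finset.sum_congr rfl fun i _ ↦ ?_
      exact algebraMap_smul R' (v i) (π (p (Pi.single i 1)))
    have hp' : Function.Surjective p' := fun m' ↦ by
      obtain ⟨m, rfl⟩ := hπ m'
      obtain ⟨v, rfl⟩ := hp m
      exact ⟨q v, hpq v⟩
    cases n with
    | zero =>
      rw [zero_add, hasProjectiveDimensionLT_one_iff_moduleProjective] at h ⊢
      obtain ⟨σ, hσ⟩ := Module.projective_lifting_property p LinearMap.id hp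
      have hle : LinearMap.ker π ≤ LinearMap.ker (q ∘ₗ σ) := fun m hm ↦ by
        obtain ⟨c, rfl⟩ := (hπx m).mp hm
        exact (hqx _).mpr ⟨σ c, map_smul _ _ _⟩
      let σ' : M' →ₗ[R] (Fin k → R') := (LinearMap.ker π).liftQ (q ∘ₗ σ) hle ∘ₗ
        (π.quotKerEquivOfSurjective hπ).symm.toLinearMap
      refine Module.Projective.of_split (σ'.extendScalarsOfSurjective hR') p' ?_
      ext m'
      obtain ⟨m, rfl⟩ := hπ m'
      change p' (σ' (π m)) = π m
      have : σ' (π m) = q (σ m) := by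
        simp [σ', LinearMap.quotKerEquivOfSurjective_symm_apply]
      rw [this, hpq]
      exact congrArg π (LinearMap.congr_fun hσ m)
    | succ n =>
      rw [hasProjectiveDimensionLT_ker_iff p hp] at h
      rw [hasProjectiveDimensionLT_ker_iff p' hp']
      let κ : LinearMap.ker p →ₗ[R] LinearMap.ker p' :=
        { toFun v := ⟨q v, by
            rw [LinearMap.mem_ker, hpq, LinearMap.mem_ker.mp v.2, map_zero]⟩
          map_add' v w := Subtype.ext (map_add q v.1 w.1)
          map_smul' r v := Subtype.ext (map_smul q r v.1) }
      refine ih _ _ κ ?_ ?_ ?_ h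
      · rintro ⟨v', hv'⟩
        obtain ⟨v, rfl⟩ := hq v'
        rw [LinearMap.mem_ker, hpq] at hv'
        obtain ⟨c, hc⟩ := (hπx _).mp hv'
        obtain ⟨w, rfl⟩ := hp c
        refine ⟨⟨v - x • w, by simp [hc]⟩, Subtype.ext ?_⟩
        change q (v - x • w) = q v
        rw [map_sub, (hqx (x • w)).mpr ⟨w, rfl⟩, sub_zero]
      · intro v
        rw [← Subtype.coe_inj]
        change q v = 0 ↔ _
        rw [hqx]
        constructor
        · rintro ⟨w, hw⟩
          refine ⟨⟨w, hxM _ ?_⟩, Subtype.ext hw⟩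
          rw [← map_smul, ← hw]
          exact v.2
        · rintro ⟨w, rfl⟩
          exact ⟨w, rfl⟩
      · rintro ⟨v, hv⟩ h0
        ext i
        exact hxr _ (congrFun (congrArg Subtype.val h0) i)

/-- If `x ∈ m \ m²`, then the residue field is a direct summand of `m ⧸ xm` over `R ⧸ (x)`. -/
theorem IsLocalRing.exists_comp_eq_id_residueField [IsLocalRing R] {R' M' : Type u} [CommRing R']
    [IsLocalRing R'] [Algebra R R'] (hR' : Function.Surjective (algebraMap R R')) {x : R}
    (hxm : x ∈ maximalIdeal R) (hx : x ∉ maximalIdeal R ^ 2) (hx0 : algebraMap R R' x = 0)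
    [AddCommGroup M'] [Module R M'] [Module R' M'] [IsScalarTower R R' M']
    (π : maximalIdeal R →ₗ[R] M') (hπ : Function.Surjective π)
    (hπx : ∀ m, π m = 0 ↔ ∃ c, m = x • c) :
    ∃ (α : (R' ⧸ maximalIdeal R') →ₗ[R'] M') (β : M' →ₗ[R'] (R' ⧸ maximalIdeal R')),
      β ∘ₗ α = LinearMap.id := by
  have : IsLocalHom (algebraMap R R') := hR'.isLocalHom
  have hcomap : ∀ r, algebraMap R R' r ∈ maximalIdeal R' ↔ r ∈ maximalIdeal R := fun r ↦ by
    rw [← Ideal.mem_comap, maximalIdeal_comap]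
  have hα : maximalIdeal R' ≤ LinearMap.ker (LinearMap.toSpanSingleton R' M' (π ⟨x, hxm⟩)) := by
    intro r' hr'
    obtain ⟨r, rfl⟩ := hR' r'
    rw [hcomap] at hr'
    rw [LinearMap.mem_ker, LinearMap.toSpanSingleton_apply, algebraMap_smul, ← map_smul, hπx]
    exact ⟨⟨r, hr'⟩, Subtype.ext (mul_comm _ _)⟩
  have hy : (maximalIdeal R).toCotangent ⟨x, hxm⟩ ≠ 0 := by
    rwa [Ne, Ideal.toCotangent_eq_zero]
  obtain ⟨f, hf⟩ := Module.Projective.exists_dual_eq_one (ResidueField R)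
    (V := CotangentSpace R) hy
  have hψ : maximalIdeal R ≤ LinearMap.ker ((maximalIdeal R').mkQ.restrictScalars R ∘ₗ
      Algebra.linearMap R R') := fun r hr ↦
    (Submodule.Quotient.mk_eq_zero _).mpr ((hcomap r).mpr hr)
  obtain ⟨ψ, hψ1⟩ : ∃ ψ : ResidueField R →ₗ[R] (R' ⧸ maximalIdeal R'),
      ψ 1 = Submodule.Quotient.mk 1 :=
    ⟨(maximalIdeal R).liftQ _ hψ, congrArg _ (map_one (algebraMap R R'))⟩
  let φ : maximalIdeal R →ₗ[R] (R' ⧸ maximalIdeal R') :=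
    ψ ∘ₗ f.restrictScalars R ∘ₗ (maximalIdeal R).toCotangent
  have hφ : φ ⟨x, hxm⟩ = Submodule.Quotient.mk 1 := (congrArg ψ hf).trans hψ1
  have hβ : LinearMap.ker π ≤ LinearMap.ker φ := fun m hm ↦ by
    obtain ⟨c, rfl⟩ := (hπx m).mp hm
    rw [LinearMap.mem_ker, map_smul, ← algebraMap_smul R', hx0, zero_smul]
  let β : M' →ₗ[R] (R' ⧸ maximalIdeal R') := (LinearMap.ker π).liftQ φ hβ ∘ₗ
    (π.quotKerEquivOfSurjective hπ).symm.toLinearMap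
  have hβπ : ∀ m, β (π m) = φ m := fun m ↦ by
    simp [β, LinearMap.quotKerEquivOfSurjective_symm_apply]
  refine ⟨(maximalIdeal R').liftQ _ hα, β.extendScalarsOfSurjective hR', ?_⟩
  refine Submodule.linearMap_qext _ (LinearMap.ext_ring ?_)
  change β ((1 : R') • π ⟨x, hxm⟩) = Submodule.Quotient.mk 1
  rw [one_smul, hβπ, hφ]

/-- If `x ∈ m \ m²` is a nonzerodivisor, then finiteness of the projective dimension of the residue
field passes from `R` to `R ⧸ (x)`. -/
theorem IsLocalRing.hasProjectiveDimensionLT_residueField_quotient [IsNoetherianRing R]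
    [IsLocalRing R] {x : R} (hxm : x ∈ maximalIdeal R) (hx : x ∉ maximalIdeal R ^ 2)
    (hxr : x ∈ nonZeroDivisors R) [IsLocalRing (R ⧸ Ideal.span {x})] (n : ℕ)
    (h : HasProjectiveDimensionLT (ModuleCat.of R (R ⧸ maximalIdeal R)) n) :
    HasProjectiveDimensionLT (ModuleCat.of (R ⧸ Ideal.span {x})
        ((R ⧸ Ideal.span {x}) ⧸ maximalIdeal (R ⧸ Ideal.span {x}))) (n + 1) := by
  have h2 := hasProjectiveDimensionLT_of_ge (ModuleCat.of R (R ⧸ maximalIdeal R)) n (n + 2)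
    (by omega)
  rw [hasProjectiveDimensionLT_ker_iff (maximalIdeal R).mkQ (Submodule.mkQ_surjective _),
    Submodule.ker_mkQ] at h2
  have hreg : ∀ r : R, x * r = 0 → r = 0 := fun r hr ↦ hxr.1 r hr
  have hπx : ∀ m, (Ideal.span {x} • ⊤ : Submodule R (maximalIdeal R)).mkQ m = 0 ↔
      ∃ c, m = x • c := fun m ↦ by
    rw [Submodule.mkQ_apply, Submodule.Quotient.mk_eq_zero,
      Submodule.ideal_span_singleton_smul, Submodule.mem_smul_pointwise_iff_exists]
    exact ⟨fun ⟨c, _, hc⟩ ↦ ⟨c, hc.symm⟩, fun ⟨c, hc⟩ ↦ ⟨c, trivial, hc.symm⟩⟩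
  obtain ⟨α, β, hαβ⟩ := exists_comp_eq_id_residueField (R' := R ⧸ Ideal.span {x})
    Ideal.Quotient.mk_surjective hxm hx
    (Ideal.Quotient.eq_zero_iff_mem.mpr (Ideal.mem_span_singleton_self x))
    (Submodule.mkQ _) (Submodule.mkQ_surjective _) hπx
  let e : Retract (ModuleCat.of (R ⧸ Ideal.span {x})
      ((R ⧸ Ideal.span {x}) ⧸ maximalIdeal (R ⧸ Ideal.span {x})))
      (ModuleCat.of (R ⧸ Ideal.span {x})
        (maximalIdeal R ⧸ (Ideal.span {x} • ⊤ : Submodule R (maximalIdeal R)))) :=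
    { i := ModuleCat.ofHom α
      r := ModuleCat.ofHom β
      retract := by rw [← ModuleCat.ofHom_comp, hαβ, ModuleCat.ofHom_id] }
  have := hasProjectiveDimensionLT_of_ker_eq_smul (R' := R ⧸ Ideal.span {x}) (x := x)
    Ideal.Quotient.mk_surjective
    (fun r ↦ by
      rw [Ideal.Quotient.algebraMap_eq, Ideal.Quotient.eq_zero_iff_mem,
        Ideal.mem_span_singleton]
      rfl) hreg (n + 1) (maximalIdeal R)
    (maximalIdeal R ⧸ (Ideal.span {x} • ⊤ : Submodule R (maximalIdeal R)))
    (Submodule.mkQ _) (Submodule.mkQ_surjective _)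
    hπx
    (fun m hm ↦ Subtype.ext (hreg _ (congrArg Subtype.val hm))) h2
  exact e.hasProjectiveDimensionLT (n + 1)

theorem IsLocalRing.spanFinrank_maximalIdeal_le_of_quotient [IsNoetherianRing R]
    [IsLocalRing R] {x : R} (hxm : x ∈ maximalIdeal R) [IsLocalRing (R ⧸ Ideal.span {x})] :
    (maximalIdeal R).spanFinrank ≤ (maximalIdeal (R ⧸ Ideal.span {x})).spanFinrank + 1 := by
  classical
  let π := Ideal.Quotient.mk (Ideal.span {x})
  have hπ : Function.Surjective π := Ideal.Quotient.mk_surjective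
  have : IsLocalHom π := hπ.isLocalHom
  obtain ⟨s, hs, hspan⟩ := Submodule.FG.exists_span_finset_card_eq_spanFinrank
    (IsNoetherian.noetherian (maximalIdeal (R ⧸ Ideal.span {x})))
  let T : Finset R := insert x (s.image (Function.surjInv hπ))
  have hT : Ideal.span (T : Set R) = maximalIdeal R := by
    have hx : x ∈ Ideal.span (T : Set R) := Ideal.subset_span (by simp [T])
    have hmap : Ideal.map π (Ideal.span (T : Set R)) = maximalIdeal (R ⧸ Ideal.span {x}) := by
      rw [Ideal.map_span, ← hspan]
      apply le_antisymm
      · rw [Ideal.span_le]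
        rintro _ ⟨t, ht, rfl⟩
        simp only [T, Finset.coe_insert, Finset.coe_image, Set.mem_insert_iff, Set.mem_image] at ht
        rcases ht with rfl | ⟨y, hy, rfl⟩
        · rw [show π t = 0 from Ideal.Quotient.eq_zero_iff_mem.mpr
            (Ideal.mem_span_singleton_self t)]
          exact zero_mem _
        · rw [Function.surjInv_eq hπ]
          exact Submodule.subset_span hy
      · refine Submodule.span_mono fun y hy ↦ ⟨Function.surjInv hπ y, ?_, Function.surjInv_eq hπ y⟩
        simp only [T, Finset.coe_insert, Finset.coe_image]
        exact Or.inr ⟨y, hy, rfl⟩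
    rw [← maximalIdeal_comap π, ← hmap, Ideal.comap_map_of_surjective π hπ, eq_comm, sup_eq_left,
      ← RingHom.ker_eq_comap_bot, Ideal.mk_ker, Ideal.span_singleton_le_iff_mem]
    exact hx
  calc (maximalIdeal R).spanFinrank ≤ T.card := by
        rw [← hT, ← Set.ncard_coe_finset]
        exact Submodule.spanFinrank_span_le_ncard_of_finite T.finite_toSet
    _ ≤ (s.image (Function.surjInv hπ)).card + 1 := Finset.card_insert_le _ _
    _ ≤ s.card + 1 := by gcongr; exact Finset.card_image_le
    _ = _ := by rw [hs]

theorem IsRegularLocalRing.of_ringKrullDim_lt (d : ℕ) : ∀ (n : ℕ) (R : Type u) [CommRing R]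
    [IsNoetherianRing R] [IsLocalRing R], ringKrullDim R < d →
    HasProjectiveDimensionLT (ModuleCat.of R (R ⧸ maximalIdeal R)) n → IsRegularLocalRing R := by
  induction d with
  | zero =>
    intro n R _ _ _ hd
    exact absurd hd (not_lt.mpr ringKrullDim_nonneg_of_nontrivial)
  | succ d ih =>
    intro n R _ _ _ hd h
    apply IsRegularLocalRing.of_spanFinrank_maximalIdeal_le
    by_cases hm : maximalIdeal R = ⊥
    · rw [hm, Submodule.spanFinrank_bot]
      exact ringKrullDim_nonneg_of_nontrivial
    obtain ⟨x, hxm, hxr, hx⟩ := exists_mem_nonZeroDivisors_notMem_sq hm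
      (maximalIdeal_notMem_associatedPrimes n h hm)
    have : Nontrivial (R ⧸ Ideal.span {x}) := Ideal.Quotient.nontrivial_iff.mpr fun htop ↦
      (maximalIdeal.isMaximal R).ne_top
        (top_le_iff.mp (htop ▸ (Ideal.span_singleton_le_iff_mem _).mpr hxm))
    have : IsLocalRing (R ⧸ Ideal.span {x}) :=
      .of_surjective' (Ideal.Quotient.mk _) Ideal.Quotient.mk_surjective
    have hdim := ringKrullDim_quotient_succ_le_of_nonZeroDivisor hxr
    have hlt : ringKrullDim (R ⧸ Ideal.span {x}) < d := by
      have := hdim.trans_lt hd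
      push_cast at this
      exact lt_of_add_lt_add_right this
    have := ih (n + 1) (R ⧸ Ideal.span {x}) hlt
      (hasProjectiveDimensionLT_residueField_quotient hxm hx hxr n h)
    refine le_trans ?_ hdim
    rw [← IsRegularLocalRing.spanFinrank_maximalIdeal (R := R ⧸ Ideal.span {x})]
    exact_mod_cast spanFinrank_maximalIdeal_le_of_quotient hxm

/-- **Serre's theorem**: a noetherian local ring whose residue field has finite projective
dimension is regular. -/
theorem IsRegularLocalRing.of_hasProjectiveDimensionLT_residueField [IsNoetherianRing R]
    [IsLocalRing R] (n : ℕ)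
    (h : HasProjectiveDimensionLT (ModuleCat.of R (R ⧸ maximalIdeal R)) n) :
    IsRegularLocalRing R := by
  obtain ⟨d, hd⟩ : ∃ d : ℕ, ringKrullDim R < d := by
    have h1 := ringKrullDim_ne_top (R := R)
    have h2 := ringKrullDim_ne_bot (R := R)
    obtain ⟨e, he⟩ := WithBot.ne_bot_iff_exists.mp h2
    rw [← he] at h1 ⊢
    lift e to ℕ using by rintro rfl; exact h1 rfl
    exact ⟨e + 1, by exact_mod_cast Nat.lt_succ_self e⟩
  exact of_ringKrullDim_lt d n R hd h

end Regular

end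

open IsLocalRing in
/-- If the maximal ideal annihilates all Ext^i for i ≥ depth R + 1, then R has an isolated
singularity: every non-maximal localization is a regular local ring (its maximal ideal is
generated by Krull-dimension many elements). -/
theorem isolated_singularity_of_ca (R : Type) [CommRing R] [IsNoetherianRing R] [IsLocalRing R]
    (t : ℕ)
    (hdepth1 : ∀ i < t,
      Subsingleton (ExtMod R i (ModuleCat.of R (R ⧸ maximalIdeal R)) (ModuleCat.of R R)))
    (hdepth2 : ¬ Subsingleton (ExtMod R t (ModuleCat.of R (R ⧸ maximalIdeal R)) (ModuleCat.of R R)))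
    (hca : ∀ i ≥ t + 1, ∀ M N : ModuleCat.{0} R, Module.Finite R M → Module.Finite R N →
      ∀ a ∈ maximalIdeal R, ∀ x : ExtMod R i M N, a • x = 0) :
    ∀ (p : Ideal R) [p.IsPrime], p ≠ maximalIdeal R →
      ∃ s : Finset (Localization.AtPrime p),
        Ideal.span (s : Set (Localization.AtPrime p)) = maximalIdeal (Localization.AtPrime p) ∧
        ringKrullDim (Localization.AtPrime p) = (s.card : WithBot (WithTop ℕ)) := by
  intro p hp hne
  obtain ⟨a, ha, hap⟩ := SetLike.exists_of_lt ((le_maximalIdeal hp.ne_top).lt_of_ne hne)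
  have : IsNoetherianRing (Localization.AtPrime p) :=
    IsLocalization.isNoetherianRing p.primeCompl _ inferInstance
  have hreg := IsRegularLocalRing.of_hasProjectiveDimensionLT_residueField _
    (hasProjectiveDimensionLT_residueField_localization p t a hap fun i hi N hN ↦
      hca i hi _ N inferInstance hN a ha)
  obtain ⟨s, hs, hspan⟩ := Submodule.FG.exists_span_finset_card_eq_spanFinrank
    (IsNoetherian.noetherian (maximalIdeal (Localization.AtPrime p)))
  refine ⟨s, hspan, ?_⟩
  rw [hs]
  exact hreg.spanFinrank_maximalIdeal.symm
end

section
/- Let (R, m, k) be a Cohen–Macaulay local ring of dimension d. Then the equality CM_m(R) = CM(R) holds if and only if m ⊆ ca^{d+1}(R). -/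
open IsLocalRing

section

open CategoryTheory

lemma smul_eq_zero_iff_of_linearEquiv {R M N : Type*} [CommRing R] [AddCommGroup M] [Module R M]
    [AddCommGroup N] [Module R N] (e : M ≃ₗ[R] N) (a : R) :
    (∀ x : M, a • x = 0) ↔ ∀ x : N, a • x = 0 := by
  refine ⟨fun H x ↦ ?_, fun H x ↦ ?_⟩
  · rw [← e.apply_symm_apply x, ← map_smul, H, map_zero]
  · rw [← e.symm_apply_apply x, ← map_smul, H, map_zero]

lemma homology_smul_eq_zero_iff {R : Type} [CommRing R] (S : ShortComplex (ModuleCat.{0} R))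
    (a : R) : (∀ x : S.homology, a • x = 0) ↔ ∀ f : S.X₂, S.g f = 0 → ∃ h, S.f h = a • f := by
  let e : S.homology ≃ₗ[R] (LinearMap.ker S.g.hom ⧸ LinearMap.range S.moduleCatToCycles) :=
    S.moduleCatHomologyIso.toLinearEquiv
  rw [smul_eq_zero_iff_of_linearEquiv e]
  constructor
  · intro H f hf
    have := H (Submodule.Quotient.mk ⟨f, hf⟩)
    rw [← Submodule.Quotient.mk_smul, Submodule.Quotient.mk_eq_zero] at this
    obtain ⟨h, hh⟩ := this
    exact ⟨h, congrArg Subtype.val hh⟩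
  · intro H x
    obtain ⟨⟨f, hf⟩, rfl⟩ := Submodule.Quotient.mk_surjective _ x
    obtain ⟨h, hh⟩ := H f hf
    rw [← Submodule.Quotient.mk_smul, Submodule.Quotient.mk_eq_zero]
    exact ⟨h, Subtype.ext hh⟩

lemma extMod_smul_eq_zero_iff_resolution {R : Type} [CommRing R] (n : ℕ) (M N : ModuleCat.{0} R)
    (P : ProjectiveResolution M) (a : R) :
    (∀ x : ExtMod R n M N, a • x = 0) ↔
      ∀ f : P.complex.X n ⟶ N, P.complex.d (n + 1) n ≫ f = 0 →
        ∃ h : P.complex.X ((ComplexShape.up ℕ).prev n) ⟶ N,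
          P.complex.d n ((ComplexShape.up ℕ).prev n) ≫ h = a • f := by
  let e : ExtMod R n M N ≃ₗ[R] ((P.complex.linearYonedaObj R N).sc n).homology :=
    (P.isoExt (R := R) n N).toLinearEquiv
  rw [smul_eq_zero_iff_of_linearEquiv e, homology_smul_eq_zero_iff]
  have hn : (ComplexShape.up ℕ).next n = n + 1 := by simp
  change (∀ f : P.complex.X n ⟶ N, P.complex.d ((ComplexShape.up ℕ).next n) n ≫ f = 0 → _) ↔ _
  rw [hn]
  rfl

lemma CategoryTheory.ProjectiveResolution.extMk_eq_zero_iff_prev {R : Type} [CommRing R] {n : ℕ}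
    {M N : ModuleCat.{0} R}
    (P : ProjectiveResolution M) (f : P.complex.X n ⟶ N) (hf : P.complex.d (n + 1) n ≫ f = 0) :
    P.extMk f (n + 1) rfl hf = 0 ↔ ∃ h : P.complex.X ((ComplexShape.up ℕ).prev n) ⟶ N,
      P.complex.d n ((ComplexShape.up ℕ).prev n) ≫ h = f := by
  cases n with
  | succ n =>
    rw [CochainComplex.prev_nat_succ]
    exact P.extMk_eq_zero_iff f _ rfl hf n rfl
  | zero =>
    rw [CochainComplex.prev_nat_zero]
    have hd : P.complex.d 0 0 = 0 := P.complex.shape _ _ (by simp)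
    simp only [hd, Limits.zero_comp, exists_const]
    constructor
    · intro h
      simp only [← P.extEquivCohomologyClass.apply_eq_iff_eq,
        extEquivCohomologyClass_extMk, extEquivCohomologyClass_zero,
        CochainComplex.HomComplex.CohomologyClass.mk_eq_zero_iff] at h
      rw [CochainComplex.HomComplex.Cocycle.toSingleMk_mem_coboundaries_iff _ _ _ _ _ 1 (by simp)]
        at h
      obtain ⟨g, hg⟩ := h
      have : g = 0 := (P.cochainComplex.isZero_of_isStrictlyLE 0 1).eq_of_src _ _
      rw [this, Limits.comp_zero] at hg
      rw [← cancel_epi (P.cochainComplexXIso (-((0 : ℕ) : ℤ)) 0 rfl).hom, Limits.comp_zero]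
      exact hg
    · rintro rfl
      simp

/-- The two constructions of `Ext` in Mathlib have the same annihilators. -/
lemma extMod_smul_eq_zero_iff {R : Type} [CommRing R] (n : ℕ) (M N : ModuleCat.{0} R) (a : R) :
    (∀ x : ExtMod R n M N, a • x = 0) ↔ ∀ x : Abelian.Ext M N n, a • x = 0 := by
  obtain ⟨P⟩ := HasProjectiveResolution.out (Z := M)
  rw [extMod_smul_eq_zero_iff_resolution n M N P]
  have key : ∀ (f : P.complex.X n ⟶ N) (hf : P.complex.d (n + 1) n ≫ f = 0),
      a • P.extMk f (n + 1) rfl hf = P.extMk (a • f) (n + 1) rfl (by simp [hf]) := by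
    intro f hf
    rw [Abelian.Ext.smul_eq_comp_mk₀, P.extMk_comp_mk₀]
    simp
  constructor
  · intro H x
    obtain ⟨f, hf, rfl⟩ := P.extMk_surjective x (n + 1) rfl
    rw [key, P.extMk_eq_zero_iff_prev]
    exact H f hf
  · intro H f hf
    have := H (P.extMk f _ rfl hf)
    rwa [key, P.extMk_eq_zero_iff_prev] at this

lemma extMod_subsingleton_iff {R : Type} [CommRing R] (n : ℕ) (M N : ModuleCat.{0} R) :
    Subsingleton (ExtMod R n M N) ↔ Subsingleton (Abelian.Ext M N n) := by
  have h := extMod_smul_eq_zero_iff n M N 1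
  simp only [one_smul] at h
  rw [subsingleton_iff_forall_eq (0 : ExtMod R n M N), h,
    subsingleton_iff_forall_eq (0 : Abelian.Ext M N n)]


namespace StablyAnn

variable {R : Type} [CommRing R] {M : ModuleCat.{0} R} {a : R}

lemma smul_ext_eq_zero (h : StablyAnn R M a) {N : ModuleCat.{0} R} {n : ℕ} (hn : 1 ≤ n)
    (x : Abelian.Ext M N n) : a • x = 0 := by
  obtain ⟨n, rfl⟩ := Nat.exists_eq_add_of_le' hn
  obtain ⟨P, _, _, _, _, f, g, hfg⟩ := h
  have hcomp : ModuleCat.ofHom f ≫ ModuleCat.ofHom g = a • 𝟙 M := by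
    ext m
    exact LinearMap.congr_fun hfg m
  have : Projective (ModuleCat.of R P) := (IsProjective.iff_projective P).mp ‹_›
  have hx : a • x = (Abelian.Ext.mk₀ (a • 𝟙 M)).comp x (zero_add _) := by
    simp [Abelian.Ext.mk₀_smul]
  rw [hx, ← hcomp, ← Abelian.Ext.mk₀_comp_mk₀_assoc,
    Abelian.Ext.eq_zero_of_projective ((Abelian.Ext.mk₀ (ModuleCat.ofHom g)).comp x _),
    Abelian.Ext.comp_zero]

lemma of_forall_smul_ext_one_eq_zero [IsNoetherianRing R] [Module.Finite R M]
    (h : ∀ N : ModuleCat.{0} R, Module.Finite R N → ∀ x : Abelian.Ext M N 1, a • x = 0) :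
    StablyAnn R M a := by
  obtain ⟨F, _, _, _, _, f, hf⟩ := Module.exists_finite_presentation R M
  have hS := LinearMap.shortExact_shortComplexKer hf
  have hfin : Module.Finite R (f.shortComplexKer).X₁ :=
    inferInstanceAs (Module.Finite R (LinearMap.ker f))
  have h0 : (Abelian.Ext.mk₀ (a • 𝟙 (f.shortComplexKer).X₃)).comp hS.extClass (zero_add 1) = 0 := by
    simpa [Abelian.Ext.mk₀_smul] using h _ hfin hS.extClass
  obtain ⟨y, hy⟩ := Abelian.Ext.covariant_sequence_exact₃ _ hS _ (zero_add 1) h0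
  obtain ⟨g, rfl⟩ := (Abelian.Ext.mk₀_bijective _ _).2 y
  rw [Abelian.Ext.mk₀_comp_mk₀] at hy
  have hg := (Abelian.Ext.mk₀_bijective _ _).1 hy
  exact ⟨F, inferInstance, inferInstance, inferInstance, inferInstance, g.hom, f,
    congrArg ModuleCat.Hom.hom hg⟩

end StablyAnn

section Depth

variable {R : Type} [CommRing R]

lemma subsingleton_ext_of_free {K F : ModuleCat.{0} R} {i : ℕ} [Module.Finite R F]
    [Module.Free R F] [Subsingleton (Abelian.Ext K (ModuleCat.of R R) i)] :
    Subsingleton (Abelian.Ext K F i) := by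
  refine subsingleton_of_forall_eq 0 fun x ↦ ?_
  let b := Module.Free.chooseBasis R F
  have hid : 𝟙 F = ∑ j, (ModuleCat.ofHom (b.coord j) ≫
      ModuleCat.ofHom (LinearMap.toSpanSingleton R F (b j))) := by
    ext v
    simp [ModuleCat.hom_sum, b.sum_repr]
  rw [← x.comp_mk₀_id, hid, Abelian.Ext.mk₀_sum, Abelian.Ext.comp_sum]
  refine Finset.sum_eq_zero fun j _ ↦ ?_
  rw [← Abelian.Ext.mk₀_comp_mk₀, ← Abelian.Ext.comp_assoc_of_second_deg_zero,
    Subsingleton.elim (x.comp _ _) 0, Abelian.Ext.zero_comp]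

lemma subsingleton_ext_left {K : ModuleCat.{0} R} {S : ShortComplex (ModuleCat.{0} R)}
    (hS : S.ShortExact) {i : ℕ} (h₂ : Subsingleton (Abelian.Ext K S.X₂ i))
    (h₃ : ∀ j, j + 1 = i → Subsingleton (Abelian.Ext K S.X₃ j)) :
    Subsingleton (Abelian.Ext K S.X₁ i) := by
  refine subsingleton_of_forall_eq 0 fun x ↦ ?_
  cases i with
  | zero =>
    have := hS.mono_f
    exact Abelian.Ext.postcomp_mk₀_injective_of_mono K S.f (Subsingleton.elim _ _)
  | succ i =>
    have := h₃ i rfl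
    obtain ⟨y, rfl⟩ := Abelian.Ext.covariant_sequence_exact₁ K hS x (Subsingleton.elim _ _) rfl
    rw [Subsingleton.elim y 0, Abelian.Ext.zero_comp]

lemma subsingleton_ext_right {K : ModuleCat.{0} R} {S : ShortComplex (ModuleCat.{0} R)}
    (hS : S.ShortExact) {i : ℕ} (h₂ : Subsingleton (Abelian.Ext K S.X₂ i))
    (h₁ : Subsingleton (Abelian.Ext K S.X₁ (i + 1))) :
    Subsingleton (Abelian.Ext K S.X₃ i) := by
  refine subsingleton_of_forall_eq 0 fun x ↦ ?_
  obtain ⟨y, rfl⟩ := Abelian.Ext.covariant_sequence_exact₃ K hS x rfl (Subsingleton.elim _ _)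
  rw [Subsingleton.elim y 0, Abelian.Ext.zero_comp]

/-- If `a` kills `Ext` out of modules of depth at least `d`, then it kills `Ext` out of modules of
depth at least `d - k` in degrees above `k`. -/
lemma smul_ext_eq_zero_of_syzygy [IsNoetherianRing R] {K : ModuleCat.{0} R} {d : ℕ}
    (hR : ∀ i < d, Subsingleton (Abelian.Ext K (ModuleCat.of R R) i)) {a : R}
    (h : ∀ M : ModuleCat.{0} R, Module.Finite R M →
      (∀ i < d, Subsingleton (Abelian.Ext K M i)) →
      ∀ (N : ModuleCat.{0} R) (j : ℕ), 1 ≤ j → ∀ x : Abelian.Ext M N j, a • x = 0)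
    (k : ℕ) (M N : ModuleCat.{0} R) [Module.Finite R M]
    (hM : ∀ i < d - k, Subsingleton (Abelian.Ext K M i)) (j : ℕ) (hj : k + 1 ≤ j)
    (x : Abelian.Ext M N j) : a • x = 0 := by
  induction k generalizing M j with
  | zero => exact h M ‹_› hM N j hj x
  | succ k ih =>
    obtain ⟨j, rfl⟩ := Nat.exists_eq_add_of_le' (show 1 ≤ j by lia)
    obtain ⟨F, _, _, _, _, f, hf⟩ := Module.exists_finite_presentation R M
    have hS := LinearMap.shortExact_shortComplexKer hf
    have hfin : Module.Finite R (f.shortComplexKer).X₁ :=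
      inferInstanceAs (Module.Finite R (LinearMap.ker f))
    have hK : ∀ i < d - k, Subsingleton (Abelian.Ext K (f.shortComplexKer).X₁ i) := by
      intro i hi
      have := hR i (by lia)
      refine subsingleton_ext_left hS ?_ fun j hj ↦ hM j (by lia)
      exact subsingleton_ext_of_free (F := ModuleCat.of R F)
    obtain ⟨y, rfl⟩ := precomp_extClass_surjective_of_projective_X₂ N hS j x
    have := ih _ hK j (by lia) y
    change a • hS.extClass.comp y (add_comm 1 j) = 0
    rw [← Abelian.Ext.comp_smul, this, Abelian.Ext.comp_zero]

lemma exists_comp_eq_smul_of_smul_ext_eq_zero {S : ShortComplex (ModuleCat.{0} R)}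
    (hS : S.ShortExact) {N : ModuleCat.{0} R} {j : ℕ} {a : R}
    (h : ∀ x : Abelian.Ext S.X₃ N (1 + j), a • x = 0) (y : Abelian.Ext S.X₁ N j) :
    ∃ z : Abelian.Ext S.X₂ N j, (Abelian.Ext.mk₀ S.f).comp z (zero_add j) = a • y :=
  Abelian.Ext.contravariant_sequence_exact₁ hS _ (a • y) rfl (by rw [Abelian.Ext.comp_smul, h])

/-- If `a` kills all `Ext` in degrees above `d`, then it kills `Ext` out of modules of depth at
least `k` in degrees above `d - k`. -/
lemma smul_ext_eq_zero_of_depth [IsNoetherianRing R] [IsLocalRing R] {d : ℕ} {a : R}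
    {N : ModuleCat.{0} R} [Module.Finite R N]
    (h : ∀ M : ModuleCat.{0} R, Module.Finite R M → ∀ j ≥ d + 1,
      ∀ x : Abelian.Ext M N j, a • x = 0)
    (k : ℕ) (M : ModuleCat.{0} R) [Module.Finite R M]
    (hM : ∀ i < k, Subsingleton (Abelian.Ext (ModuleCat.of R (R ⧸ maximalIdeal R)) M i))
    (j : ℕ) (hj : d + 1 ≤ j + k) (y : Abelian.Ext M N j) : a • y = 0 := by
  induction k generalizing M j with
  | zero => exact h M ‹_› j hj y
  | succ k ih =>
    have h0 := hM 0 (by lia)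
    have : Subsingleton ((R ⧸ maximalIdeal R) →ₗ[R] M) :=
      ((Abelian.Ext.addEquiv₀ (X := ModuleCat.of R (R ⧸ maximalIdeal R))
        (Y := M)).trans ModuleCat.homAddEquiv).symm.subsingleton
    obtain ⟨r, hr, hreg⟩ := IsSMulRegular.subsingleton_linearMap_iff.mp this
    rw [Ideal.annihilator_quotient] at hr
    have hmem : a • y ∈ (⨅ t : ℕ, maximalIdeal R ^ t • ⊤ : Submodule R (Abelian.Ext M N j)) := by
      rw [Submodule.mem_iInf]
      intro t
      have hS := (hreg.pow t).smulShortComplex_shortExact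
      have hfin : Module.Finite R (M.smulShortComplex (r ^ t)).X₃ :=
        inferInstanceAs (Module.Finite R (QuotSMulTop (r ^ t) M))
      obtain ⟨z, hz⟩ := exists_comp_eq_smul_of_smul_ext_eq_zero hS (ih _
        (fun i hi ↦ subsingleton_ext_right hS (hM i (by lia)) (hM (i + 1) (by lia)))
        (1 + j) (by lia)) y
      have hz' : (Abelian.Ext.mk₀ (r ^ t • 𝟙 M)).comp (show Abelian.Ext M N j from z)
        (zero_add j) = a • y := hz
      rw [← hz', Abelian.Ext.mk₀_smul, Abelian.Ext.smul_comp, Abelian.Ext.mk₀_id_comp]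
      exact Submodule.smul_mem_smul (Ideal.pow_mem_pow hr t) trivial
    rwa [Ideal.iInf_pow_smul_eq_bot_of_isLocalRing _ (Ideal.IsPrime.ne_top'), Submodule.mem_bot]
      at hmem

end Depth

end

open IsLocalRing in
/-- For a CM local ring of dimension d: every maximal Cohen-Macaulay module has stable
annihilator containing m iff m is contained in the (d+1)-st cohomology annihilator. -/
theorem cm_m_eq_cm_iff (R : Type) [CommRing R] [IsNoetherianRing R] [IsLocalRing R]
    (d : ℕ) (hdim : ringKrullDim R = d)
    (hCMring : ∀ i < d,
      Subsingleton (ExtMod R i (ModuleCat.of R (R ⧸ maximalIdeal R)) (ModuleCat.of R R))) :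
    (∀ M : ModuleCat.{0} R, Module.Finite R M →
        (∀ i < d, Subsingleton (ExtMod R i (ModuleCat.of R (R ⧸ maximalIdeal R)) M)) →
        ∀ a ∈ maximalIdeal R, StablyAnn R M a) ↔
      (∀ i ≥ d + 1, ∀ M N : ModuleCat.{0} R, Module.Finite R M → Module.Finite R N →
        ∀ a ∈ maximalIdeal R, ∀ x : ExtMod R i M N, a • x = 0) := by
  simp only [extMod_subsingleton_iff] at hCMring ⊢
  constructor
  · intro H i hi M N _ _ a ha
    rw [extMod_smul_eq_zero_iff]
    refine smul_ext_eq_zero_of_syzygy hCMring (fun M hM hd N j hj x ↦ ?_) d M N (by simp) i hi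
    exact (H M hM hd a ha).smul_ext_eq_zero hj x
  · intro H M _ hM a ha
    refine StablyAnn.of_forall_smul_ext_one_eq_zero fun N _ x ↦ ?_
    refine smul_ext_eq_zero_of_depth (d := d) (fun M hM j hj ↦ ?_) d M hM 1 (by lia) x
    exact (extMod_smul_eq_zero_iff j M N a).mp (H j hj M N hM ‹_› a ha)
end

section
/- Let (R, m, k) be a Gorenstein local ring and let M and N be maximal Cohen–Macaulay R-modules with M a syzygy of N, i.e., there is an exact sequence 0 → M → F → N → 0 with F finitely generated free. Then the stable annihilators of M and N coincide: ann̲_R(M) = ann̲_R(N) (up to free summands of M). -/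
open IsLocalRing

open CategoryTheory Abelian RingTheory.Sequence

/-- The derived-functor `Ext` vanishes only if the derived-category `Ext` does. -/
lemma subsingleton_abelianExt_of_subsingleton_extMod {R : Type} [CommRing R] {n : ℕ}
    {X Y : ModuleCat.{0} R} (h : Subsingleton (ExtMod R n X Y)) :
    Subsingleton (Abelian.Ext X Y n) := by
  let P := projectiveResolution X
  have hz : Limits.IsZero ((P.complex.linearYonedaObj R Y).homology n) :=
    (ModuleCat.isZero_iff_subsingleton.mpr h).of_iso (P.isoExt n Y).symm
  rw [← HomologicalComplex.exactAt_iff_isZero_homology] at hz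
  have exact_at (p : ℕ) (hp : (ComplexShape.up ℕ).prev n = p) (f : P.complex.X n ⟶ Y)
      (hf : P.complex.d (n + 1) n ≫ f = 0) :
      ∃ g : P.complex.X p ⟶ Y, P.complex.d n p ≫ g = f := by
    rw [HomologicalComplex.exactAt_iff' _ p n (n + 1) hp (by simp),
      ShortComplex.moduleCat_exact_iff] at hz
    exact hz f hf
  suffices ∀ α : Abelian.Ext X Y n, α = 0 from ⟨fun α β => (this α).trans (this β).symm⟩
  intro α
  obtain ⟨f, hf, rfl⟩ := P.extMk_surjective α (n + 1) rfl
  cases n with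
  | zero =>
    obtain ⟨g, rfl⟩ := exact_at 0 (by simp) f hf
    simp
  | succ p =>
    exact (P.extMk_eq_zero_iff f _ rfl hf p rfl).mpr (exact_at p (by simp) f hf)

lemma subsingleton_ext_of_linearEquiv {R : Type} [CommRing R]
    {A B : Type} [AddCommGroup A] [Module R A]
    [AddCommGroup B] [Module R B] (e : A ≃ₗ[R] B) (Y : ModuleCat.{0} R) (i : ℕ)
    (h : Subsingleton (Abelian.Ext (ModuleCat.of R B) Y i)) :
    Subsingleton (Abelian.Ext (ModuleCat.of R A) Y i) := by
  suffices ∀ α : Abelian.Ext (ModuleCat.of R A) Y i, α = 0 from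
    ⟨fun α β => (this α).trans (this β).symm⟩
  intro α
  have hα : (Ext.mk₀ e.toModuleIso.inv).comp α (zero_add i) = 0 := h.elim _ _
  have := congrArg (fun β => (Ext.mk₀ e.toModuleIso.hom).comp β (zero_add i)) hα
  simpa only [Ext.mk₀_comp_mk₀_assoc, Iso.hom_inv_id, Ext.mk₀_id_comp, Ext.comp_zero] using this

/-- A nonzero map out of the residue field is injective. -/
lemma injective_of_ne_zero_of_residue {R : Type} [CommRing R] [IsLocalRing R]
    {Q : Type} [AddCommGroup Q] [Module R Q]
    (φ : (R ⧸ maximalIdeal R) →ₗ[R] Q) (hφ : φ ≠ 0) : Function.Injective φ := by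
  have : IsSimpleModule R (R ⧸ maximalIdeal R) :=
    isSimpleModule_iff_isCoatom.mpr (Ideal.isMaximal_def.mp inferInstance)
  exact (LinearMap.injective_or_eq_zero φ).resolve_right hφ

section

variable {R : Type} [CommRing R] [IsNoetherianRing R] [IsLocalRing R]

/-- Vanishing of `Ext` descends along a regular element, by Nakayama's lemma. -/
lemma subsingleton_ext_of_quotSMulTop (L Y : ModuleCat.{0} R) [Module.Finite R L]
    [Module.Finite R Y] {x : R} (hx : x ∈ maximalIdeal R) (reg : IsSMulRegular L x) (i : ℕ)
    (h : Subsingleton (Abelian.Ext (ModuleCat.of R (QuotSMulTop x L)) Y (i + 1))) :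
    Subsingleton (Abelian.Ext L Y i) := by
  have hS := reg.smulShortComplex_shortExact
  by_contra! ntr
  have hxj : x ∈ (Module.annihilator R (Abelian.Ext L Y i)).jacobson :=
    (IsLocalRing.maximalIdeal_le_jacobson _) hx
  refine Submodule.top_ne_pointwise_smul_of_mem_jacobson_annihilator hxj ?_
  rw [eq_comm, eq_top_iff]
  intro y _
  obtain ⟨z, hz⟩ : ∃ z : Abelian.Ext L Y i, (Ext.mk₀ (x • 𝟙 L)).comp z (zero_add i) = y :=
    Ext.contravariant_sequence_exact₁ hS Y y (add_comm 1 i) (h.elim _ _)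
  rw [Ext.mk₀_smul, Ext.smul_comp, Ext.mk₀_id_comp] at hz
  rw [← hz]
  exact Submodule.smul_mem_pointwise_smul _ _ ⊤ trivial

/-- Vanishing of `Ext` into a finite module in all degrees at least `n` can be tested on the
residue field. -/
lemma subsingleton_ext_of_residue (Y : ModuleCat.{0} R) [Module.Finite R Y] (n : ℕ)
    (h : ∀ i ≥ n, Subsingleton (Abelian.Ext (ModuleCat.of R (R ⧸ maximalIdeal R)) Y i))
    (L : Type) [AddCommGroup L] [Module R L] [Module.Finite R L] :
    ∀ i ≥ n, Subsingleton (Abelian.Ext (ModuleCat.of R L) Y i) := by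
  suffices ∀ (I : Ideal R) (L : Type) [AddCommGroup L] [Module R L] [Module.Finite R L],
      I ≤ Module.annihilator R L →
      ∀ i ≥ n, Subsingleton (Abelian.Ext (ModuleCat.of R L) Y i) from
    this ⊥ L bot_le
  intro I
  induction I using IsNoetherian.induction with
  | hgt I ih =>
  intro L _ _ _
  refine IsNoetherianRing.induction_on_isQuotientEquivQuotientPrime R (M := L) ‹_›
    (motive := fun N _ _ _ => I ≤ Module.annihilator R N →
      ∀ i ≥ n, Subsingleton (Abelian.Ext (ModuleCat.of R N) Y i)) ?_ ?_ ?_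
  · intro N _ _ _ _ _ i _
    have hN : Limits.IsZero (ModuleCat.of R N) :=
      ModuleCat.isZero_iff_subsingleton.mpr ‹_›
    have := hN.hasProjectiveDimensionLT_zero
    exact HasProjectiveDimensionLT.subsingleton _ 0 i (Nat.zero_le _) _
  · intro N _ _ _ p e hI i hi
    have hann : Module.annihilator R N = p.1 := by
      rw [e.annihilator_eq, Ideal.annihilator_quotient]
    rw [hann] at hI
    by_cases hp : p.1 = maximalIdeal R
    · rw [hp] at e
      exact subsingleton_ext_of_linearEquiv e Y i (h i hi)
    obtain ⟨x, hxm, hxp⟩ : ∃ x ∈ maximalIdeal R, x ∉ p.1 := by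
      by_contra! hc
      exact hp (le_antisymm (IsLocalRing.le_maximalIdeal p.2.ne_top) hc)
    have reg : IsSMulRegular N x := by
      rw [e.isSMulRegular_congr, isSMulRegular_quotient_iff_mem_of_smul_mem]
      intro y hy
      exact (p.2.mem_or_mem hy).resolve_left hxp
    refine subsingleton_ext_of_quotSMulTop (ModuleCat.of R N) Y hxm reg i ?_
    refine ih (p.1 ⊔ Ideal.span {x}) ?_ (QuotSMulTop x N) ?_ (i + 1) (by omega)
    · refine lt_of_le_of_ne (hI.trans le_sup_left) fun hc => hxp (hI ?_)
      rw [hc]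
      exact Ideal.mem_sup_right (Ideal.mem_span_singleton_self x)
    · refine sup_le ?_ ?_
      · rw [← hann]
        exact LinearMap.annihilator_le_of_surjective _ (Submodule.mkQ_surjective _)
      · rw [Ideal.span_singleton_le_iff_mem]
        exact QuotSMulTop.mem_annihilator N x
  · intro N₁ _ _ _ N₂ _ _ _ N₃ _ _ _ f g hf hg hfg h₁ h₃ hI i hi
    let S := ModuleCat.shortComplexOfCompEqZero f g hfg.linearMap_comp_eq_zero
    have hS : S.ShortExact := ModuleCat.shortComplex_shortExact S hfg hf hg
    have k₁ := h₁ (hI.trans (LinearMap.annihilator_le_of_injective f hf)) i hi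
    have k₃ := h₃ (hI.trans (LinearMap.annihilator_le_of_surjective g hg)) i hi
    suffices ∀ α : Abelian.Ext S.X₂ Y i, α = 0 from
      ⟨fun α β => (this α).trans (this β).symm⟩
    intro α
    obtain ⟨β, rfl⟩ := Ext.contravariant_sequence_exact₂ hS Y α (k₁.elim _ _)
    rw [k₃.elim β 0, Ext.comp_zero]

/-- If `Q` is finite and admits no nonzero map from the residue field, the maximal ideal
contains a `Q`-regular element. -/
lemma exists_isSMulRegular_of_subsingleton_residue (Q : Type) [AddCommGroup Q] [Module R Q]
    [Module.Finite R Q] (h : Subsingleton ((R ⧸ maximalIdeal R) →ₗ[R] Q)) :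
    ∃ x ∈ maximalIdeal R, IsSMulRegular Q x := by
  obtain ⟨x, hx, reg⟩ := IsSMulRegular.subsingleton_linearMap_iff.mp h
  rw [Ideal.annihilator_quotient] at hx
  exact ⟨x, hx, reg⟩

/-- There is a regular sequence `rs`, no longer than the Krull dimension, such that the residue
field embeds into `R ⧸ (rs)`. -/
lemma exists_isRegular_residue_embedding {d : ℕ} (hdim : ringKrullDim R = d) :
    ∃ rs : List R, IsRegular R rs ∧ (∀ r ∈ rs, r ∈ maximalIdeal R) ∧ rs.length ≤ d ∧
      ∃ φ : (R ⧸ maximalIdeal R) →ₗ[R] R ⧸ (Ideal.ofList rs • (⊤ : Submodule R R)),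
        Function.Injective φ := by
  have bound (rs : List R) (reg : IsRegular R rs) : rs.length ≤ d := by
    have := ringKrullDim_add_length_eq_ringKrullDim_of_isRegular rs reg
    rw [hdim] at this
    have : Nontrivial (R ⧸ Ideal.ofList rs) :=
      Ideal.Quotient.nontrivial_iff.mpr fun h => reg.top_ne_smul (by rw [h]; simp)
    have h : (rs.length : WithBot ℕ∞) ≤ d := by
      rw [← ‹_ + _ = (d : WithBot ℕ∞)›]
      exact le_add_of_nonneg_left ringKrullDim_nonneg_of_nontrivial
    exact_mod_cast h
  let S : Set ℕ := {n | ∃ rs : List R, IsRegular R rs ∧ (∀ r ∈ rs, r ∈ maximalIdeal R) ∧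
    rs.length = n}
  have hS : BddAbove S := ⟨d, by rintro _ ⟨rs, reg, -, rfl⟩; exact bound rs reg⟩
  have hne : S.Nonempty := ⟨0, [], IsRegular.nil R R, by simp, rfl⟩
  obtain ⟨rs, reg, mem, len⟩ := Nat.sSup_mem hne hS
  refine ⟨rs, reg, mem, bound rs reg, ?_⟩
  by_contra! hno
  obtain ⟨x, hx, hreg⟩ := exists_isSMulRegular_of_subsingleton_residue (R := R)
    (R ⧸ (Ideal.ofList rs • (⊤ : Submodule R R))) <| by
      refine ⟨fun φ ψ => ?_⟩
      have key (χ : (R ⧸ maximalIdeal R) →ₗ[R] R ⧸ (Ideal.ofList rs • (⊤ : Submodule R R))) :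
          χ = 0 := by_contra fun hχ => hno χ (injective_of_ne_zero_of_residue χ hχ)
      rw [key φ, key ψ]
  have mem' : ∀ r ∈ rs ++ [x], r ∈ maximalIdeal R := by
    intro r hr
    rcases List.mem_append.mp hr with hr | hr
    · exact mem r hr
    · rwa [List.mem_singleton.mp hr]
  have hlong : rs.length + 1 ∈ S := by
    refine ⟨rs ++ [x], ?_, mem', by simp⟩
    rw [IsLocalRing.isRegular_iff_isWeaklyRegular_of_subset_maximalIdeal mem',
      isWeaklyRegular_append_iff, isWeaklyRegular_singleton_iff]
    exact ⟨reg.toIsWeaklyRegular, hreg⟩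
  have := le_csSup hS hlong
  omega

/-- If `Ext(k, R)` vanishes in large degrees, then `Ext(L, R)` vanishes above the dimension for
every finite module `L`. -/
lemma subsingleton_ext_self_of_lt {d : ℕ} (hdim : ringKrullDim R = d)
    (hGor : ∃ n : ℕ, ∀ i ≥ n, Subsingleton
      (Abelian.Ext (ModuleCat.of R (R ⧸ maximalIdeal R)) (ModuleCat.of R R) i))
    (L : Type) [AddCommGroup L] [Module R L] [Module.Finite R L] (i : ℕ) (hi : d < i) :
    Subsingleton (Abelian.Ext (ModuleCat.of R L) (ModuleCat.of R R) i) := by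
  obtain ⟨rs, reg, mem, hlen, φ, hφ⟩ := exists_isRegular_residue_embedding hdim
  have hpd : HasProjectiveDimensionLT
      (ModuleCat.of R (R ⧸ (Ideal.ofList rs • (⊤ : Submodule R R)))) (rs.length + 1) := by
    have h := ModuleCat.projectiveDimension_quotient_eq_add_length_of_isWeaklyRegular
      (ModuleCat.of R R) rs reg.toIsWeaklyRegular mem
    have : Nontrivial (ModuleCat.of R R) := inferInstanceAs (Nontrivial R)
    rw [ModuleCat.projectiveDimension_eq_zero_of_projective (ModuleCat.of R R), zero_add] at h
    exact (projectiveDimension_le_iff _ _).mp h.le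
  let S := ModuleCat.shortComplexOfCompEqZero φ (LinearMap.range φ).mkQ
    (LinearMap.range_mkQ_comp φ)
  have hS : S.ShortExact := ModuleCat.shortComplex_shortExact S
    (LinearMap.exact_map_mkQ_range φ) hφ (Submodule.mkQ_surjective _)
  have step (n : ℕ) (hn : d < n) (h : ∀ i ≥ n + 1, Subsingleton
      (Abelian.Ext (ModuleCat.of R (R ⧸ maximalIdeal R)) (ModuleCat.of R R) i)) :
      Subsingleton (Abelian.Ext (ModuleCat.of R (R ⧸ maximalIdeal R)) (ModuleCat.of R R) n) := by
    have hC : Subsingleton (Abelian.Ext S.X₃ (ModuleCat.of R R) (n + 1)) :=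
      subsingleton_ext_of_residue (ModuleCat.of R R) (n + 1) h _ (n + 1) le_rfl
    have hQ : Subsingleton (Abelian.Ext S.X₂ (ModuleCat.of R R) n) :=
      hpd.subsingleton _ _ n (by omega) _
    suffices ∀ α : Abelian.Ext S.X₁ (ModuleCat.of R R) n, α = 0 from
      ⟨fun α β => (this α).trans (this β).symm⟩
    intro α
    obtain ⟨β, rfl⟩ := Ext.contravariant_sequence_exact₁ hS _ α (add_comm 1 n) (hC.elim _ _)
    rw [hQ.elim β 0, Ext.comp_zero]
  have hk : ∀ i ≥ d + 1, Subsingleton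
      (Abelian.Ext (ModuleCat.of R (R ⧸ maximalIdeal R)) (ModuleCat.of R R) i) := by
    obtain ⟨n, hn⟩ := hGor
    have aux (m : ℕ) : ∀ i ≥ n - m, d < i → Subsingleton
        (Abelian.Ext (ModuleCat.of R (R ⧸ maximalIdeal R)) (ModuleCat.of R R) i) := by
      induction m with
      | zero => exact fun i hi _ => hn i hi
      | succ m ih =>
        intro i hi hdi
        exact step i hdi fun j hj => ih j (by omega) (by omega)
    exact fun i hi => aux n i (by omega) (by omega)
  exact subsingleton_ext_of_residue (ModuleCat.of R R) (d + 1) hk L i hi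

/-- Each degree of vanishing of `Ext(k, N)` lowers by one the bound above which `Ext(N, Y)`
vanishes. -/
lemma subsingleton_ext_of_depth (Y : ModuleCat.{0} R) [Module.Finite R Y] {d : ℕ}
    (hY : ∀ (L : Type) [AddCommGroup L] [Module R L] [Module.Finite R L], ∀ i > d,
      Subsingleton (Abelian.Ext (ModuleCat.of R L) Y i))
    (j : ℕ) (N : Type) [AddCommGroup N] [Module R N] [Module.Finite R N]
    (hN : ∀ i < j, Subsingleton
      (Abelian.Ext (ModuleCat.of R (R ⧸ maximalIdeal R)) (ModuleCat.of R N) i))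
    (i : ℕ) (hi : d < i + j) :
    Subsingleton (Abelian.Ext (ModuleCat.of R N) Y i) := by
  induction j generalizing N i with
  | zero => exact hY N i hi
  | succ j ih =>
    have h0 := hN 0 (Nat.succ_pos j)
    obtain ⟨x, hx, reg⟩ := exists_isSMulRegular_of_subsingleton_residue (R := R) N
      ((Ext.addEquiv₀ (X := ModuleCat.of R (R ⧸ maximalIdeal R)) (Y := ModuleCat.of R N)).trans
        ModuleCat.homAddEquiv).symm.toEquiv.subsingleton
    refine subsingleton_ext_of_quotSMulTop (ModuleCat.of R N) Y hx reg i ?_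
    refine ih (QuotSMulTop x N) (fun l hl => ?_) (i + 1) (by omega)
    have hS := IsSMulRegular.smulShortComplex_shortExact (M := ModuleCat.of R N) reg
    have h₁ := hN (l + 1) (by omega)
    have h₂ := hN l (by omega)
    suffices ∀ α : Abelian.Ext (ModuleCat.of R (R ⧸ maximalIdeal R))
        ((ModuleCat.of R N).smulShortComplex x).X₃ l, α = 0 from
      ⟨fun α β => (this α).trans (this β).symm⟩
    intro α
    obtain ⟨β, rfl⟩ := Ext.covariant_sequence_exact₃ _ hS α rfl (h₁.elim _ _)
    have hβ : β = 0 := h₂.elim _ _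
    rw [hβ, Ext.zero_comp]

end

section

variable {R : Type} [CommRing R]

/-- A map into a finite projective module extends along `f` if functionals do. -/
lemma exists_comp_eq_of_projective {M F P : Type} [AddCommGroup M] [Module R M]
    [AddCommGroup F] [Module R F] [AddCommGroup P] [Module R P] [Module.Finite R P]
    [Module.Projective R P] (f : M →ₗ[R] F)
    (h : ∀ φ : M →ₗ[R] R, ∃ ψ : F →ₗ[R] R, ψ ∘ₗ f = φ) (u : M →ₗ[R] P) :
    ∃ v : F →ₗ[R] P, v ∘ₗ f = u := by
  obtain ⟨n, p, i, -, -, hpi⟩ := Module.Finite.exists_comp_eq_id_of_projective R P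
  choose ψ hψ using fun j : Fin n => h (LinearMap.proj j ∘ₗ i ∘ₗ u)
  refine ⟨p ∘ₗ LinearMap.pi ψ, ?_⟩
  have : LinearMap.pi ψ ∘ₗ f = i ∘ₗ u := by
    ext m j
    exact LinearMap.congr_fun (hψ j) m
  rw [LinearMap.comp_assoc, this, ← LinearMap.comp_assoc, hpi, LinearMap.id_comp]

variable {M F N : Type} [AddCommGroup M] [Module R M] [AddCommGroup F] [Module R F]
  [AddCommGroup N] [Module R N] {f : M →ₗ[R] F} {g : F →ₗ[R] N}

/-- The stable annihilator of a module is contained in that of any of its syzygies. -/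
lemma StablyAnn.syzygy [Module.Finite R F] [Module.Projective R F] (hf : Function.Injective f)
    (hg : Function.Surjective g) (hfg : Function.Exact f g) {a : R} (h : StablyAnn R N a) :
    StablyAnn R M a := by
  obtain ⟨P, _, _, _, _, u, v, hvu⟩ := h
  obtain ⟨w, rfl⟩ := Module.projective_lifting_property g v hg
  let e : F →ₗ[R] F := a • LinearMap.id - w ∘ₗ u ∘ₗ g
  have he (y : F) : ∃ m, f m = e y := (hfg _).mp <| by
    have := LinearMap.congr_fun hvu (g y)
    simp only [LinearMap.comp_apply, LinearMap.smul_apply, LinearMap.id_apply] at this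
    simp [e, this]
  let k : F →ₗ[R] M := (LinearEquiv.ofInjective f hf).symm.toLinearMap ∘ₗ
    e.codRestrict (LinearMap.range f) he
  have hk (y : F) : f (k y) = e y := by
    have := LinearEquiv.apply_symm_apply (LinearEquiv.ofInjective f hf)
      (e.codRestrict (LinearMap.range f) he y)
    exact congrArg Subtype.val this
  refine ⟨F, _, _, ‹_›, ‹_›, f, k, ?_⟩
  ext m
  apply hf
  rw [LinearMap.comp_apply, hk]
  simp [e, hfg.apply_apply_eq_zero]

/-- The stable annihilator of a syzygy is contained in that of the module, provided that
functionals on the syzygy extend. -/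
lemma StablyAnn.cosyzygy [Module.Finite R F] [Module.Projective R F]
    (hg : Function.Surjective g) (hfg : Function.Exact f g)
    (hext : ∀ φ : M →ₗ[R] R, ∃ ψ : F →ₗ[R] R, ψ ∘ₗ f = φ) {a : R} (h : StablyAnn R M a) :
    StablyAnn R N a := by
  obtain ⟨P, _, _, _, _, u, v, hvu⟩ := h
  obtain ⟨w, rfl⟩ := exists_comp_eq_of_projective f hext u
  let e : F →ₗ[R] F := a • LinearMap.id - f ∘ₗ v ∘ₗ w
  have he : LinearMap.ker g ≤ LinearMap.ker e := by
    intro y hy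
    obtain ⟨m, rfl⟩ := (hfg y).mp hy
    have := LinearMap.congr_fun hvu m
    simp only [LinearMap.comp_apply, LinearMap.smul_apply, LinearMap.id_apply] at this
    simp [e, this]
  let k : N →ₗ[R] F := (LinearMap.ker g).liftQ e he ∘ₗ
    (g.quotKerEquivOfSurjective hg).symm.toLinearMap
  have hk (y : F) : k (g y) = e y := by
    have : (g.quotKerEquivOfSurjective hg).symm (g y) = (LinearMap.ker g).mkQ y :=
      (LinearEquiv.symm_apply_eq _).mpr rfl
    simp [k, this]
  refine ⟨F, _, _, ‹_›, ‹_›, k, g, ?_⟩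
  ext z
  obtain ⟨y, rfl⟩ := hg z
  rw [LinearMap.comp_apply, hk]
  simp [e, hfg.apply_apply_eq_zero]

end

open IsLocalRing in
/-- Over a Gorenstein local ring, the stable annihilators of a maximal Cohen-Macaulay
module and of its cosyzygy coincide. Gorensteinness is expressed by eventual vanishing of
Ext(k, R), and depth conditions via vanishing of Ext against the residue field. -/
theorem stablyAnn_syzygy_eq_gorenstein (R : Type) [CommRing R] [IsNoetherianRing R]
    [IsLocalRing R] (d : ℕ) (hdim : ringKrullDim R = d)
    (hGor : ∃ n : ℕ, ∀ i ≥ n,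
      Subsingleton (ExtMod R i (ModuleCat.of R (R ⧸ maximalIdeal R)) (ModuleCat.of R R)))
    (M N : Type) [AddCommGroup M] [Module R M] [Module.Finite R M]
    [AddCommGroup N] [Module R N] [Module.Finite R N]
    (hM : ∀ i < d,
      Subsingleton (ExtMod R i (ModuleCat.of R (R ⧸ maximalIdeal R)) (ModuleCat.of R M)))
    (hN : ∀ i < d,
      Subsingleton (ExtMod R i (ModuleCat.of R (R ⧸ maximalIdeal R)) (ModuleCat.of R N)))
    (s : ℕ) (f : M →ₗ[R] (Fin s → R)) (g : (Fin s → R) →ₗ[R] N)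
    (hf : Function.Injective f) (hg : Function.Surjective g)
    (hfg : LinearMap.range f = LinearMap.ker g) :
    ∀ a : R, StablyAnn R M a ↔ StablyAnn R N a := by
  have hexact : Function.Exact f g := LinearMap.exact_iff.mpr hfg.symm
  obtain ⟨n, hn⟩ := hGor
  have hvanish : Subsingleton (Abelian.Ext (ModuleCat.of R N) (ModuleCat.of R R) 1) :=
    subsingleton_ext_of_depth (ModuleCat.of R R)
      (subsingleton_ext_self_of_lt hdim
        ⟨n, fun i hi => subsingleton_abelianExt_of_subsingleton_extMod (hn i hi)⟩)
      d N (fun i hi => subsingleton_abelianExt_of_subsingleton_extMod (hN i hi)) 1 (by omega)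
  let S := ModuleCat.shortComplexOfCompEqZero f g hexact.linearMap_comp_eq_zero
  have hS : S.ShortExact := ModuleCat.shortComplex_shortExact S hexact hf hg
  refine fun a => ⟨StablyAnn.cosyzygy hg hexact fun φ => ?_, StablyAnn.syzygy hf hg hexact⟩
  obtain ⟨β, hβ⟩ := Ext.contravariant_sequence_exact₁ hS (ModuleCat.of R R)
    (Ext.mk₀ (ModuleCat.ofHom φ)) (add_zero 1) (hvanish.elim _ _)
  obtain ⟨ψ, rfl⟩ := (Ext.mk₀_bijective S.X₂ (ModuleCat.of R R)).2 β
  rw [Ext.mk₀_comp_mk₀, (Ext.mk₀_bijective _ _).1.eq_iff] at hβ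
  exact ⟨ψ.hom, congrArg ModuleCat.Hom.hom hβ⟩
end

section
/- Let R → S be a flat local homomorphism of noetherian local rings, M a finitely generated R-module, and n ≥ 0. Then ann_R Ext_R^n(M, Ω_R^n M) equals the contraction to R of ann_S Ext_S^n(M ⊗_R S, Ω_S^n(M ⊗_R S)). -/
open IsLocalRing

open CategoryTheory TensorProduct

theorem CategoryTheory.ShortComplex.forall_smul_homology_eq_zero_iff {A : Type} [CommRing A]
    (T : ShortComplex (ModuleCat.{0} A)) (a : A) :
    (∀ x : T.homology, a • x = 0) ↔
      ∀ b : T.X₂, T.g.hom b = 0 → ∃ y : T.X₁, T.f.hom y = a • b := by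
  let H := LinearMap.ker T.g.hom ⧸ LinearMap.range T.moduleCatToCycles
  let e : T.homology ≃ₗ[A] H := T.moduleCatHomologyIso.toLinearEquiv
  have key (z : LinearMap.ker T.g.hom) :
      a • (Submodule.Quotient.mk z : H) = 0 ↔ ∃ y : T.X₁, T.f.hom y = a • (z : T.X₂) := by
    rw [← Submodule.Quotient.mk_smul, Submodule.Quotient.mk_eq_zero, LinearMap.mem_range]
    simp only [Subtype.ext_iff]
    rfl
  trans ∀ x : H, a • x = 0
  · refine ⟨fun h x => ?_, fun h x => ?_⟩
    · rw [← e.symm.map_eq_zero_iff, map_smul, h]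
    · rw [← e.map_eq_zero_iff, map_smul, h]
  · refine ⟨fun h b hb => (key ⟨b, hb⟩).1 (h _), fun h x => ?_⟩
    obtain ⟨z, rfl⟩ := Submodule.Quotient.mk_surjective _ x
    exact (key z).2 (h z z.2)

theorem forall_smul_extMod_eq_zero_iff {A : Type} [CommRing A] {M N : ModuleCat.{0} A}
    (P : ProjectiveResolution M) (a : A)
    {m n : ℕ} (hm : (ComplexShape.up ℕ).prev n = m) :
    (∀ x : ExtMod A n M N, a • x = 0) ↔
      ∀ f : P.complex.X n →ₗ[A] N, f ∘ₗ (P.complex.d (n + 1) n).hom = 0 →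
        ∃ g : P.complex.X m →ₗ[A] N, g ∘ₗ (P.complex.d n m).hom = a • f := by
  subst hm
  let e : ExtMod A n M N ≃ₗ[A] (P.complex.linearYonedaObj A N).homology n :=
    (P.isoExt (R := A) n N).toLinearEquiv
  trans ∀ x : (P.complex.linearYonedaObj A N).homology n, a • x = 0
  · refine ⟨fun h x => ?_, fun h x => ?_⟩
    · rw [← e.symm.map_eq_zero_iff, map_smul, h]
    · rw [← e.map_eq_zero_iff, map_smul, h]
  · refine (ShortComplex.forall_smul_homology_eq_zero_iff _ a).trans ?_
    have hn : (ComplexShape.up ℕ).next n = n + 1 := by simp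
    refine ⟨fun h f hf => ?_, fun h f hf => ?_⟩
    · obtain ⟨g, hg⟩ := h (ModuleCat.ofHom f) (by
        change P.complex.d ((ComplexShape.up ℕ).next n) n ≫ ModuleCat.ofHom f = 0
        rw [hn]
        exact ModuleCat.hom_ext hf)
      exact ⟨ModuleCat.Hom.hom g, congrArg ModuleCat.Hom.hom hg⟩
    · obtain ⟨g, hg⟩ := h (ModuleCat.Hom.hom f) (by
        change P.complex.d ((ComplexShape.up ℕ).next n) n ≫ f = 0 at hf
        rw [hn] at hf
        exact congrArg ModuleCat.Hom.hom hf)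
      exact ⟨ModuleCat.ofHom g, ModuleCat.hom_ext hg⟩

theorem LinearMap.forall_exists_smul_iff_baseChange {R S A B C : Type*} [CommRing R] [CommRing S]
    [Algebra R S] [Module.FaithfullyFlat R S] [AddCommGroup A] [AddCommGroup B] [AddCommGroup C]
    [Module R A] [Module R B] [Module R C] (α : A →ₗ[R] B) (β : B →ₗ[R] C) (a : R) :
    (∀ b, β b = 0 → ∃ y, α y = a • b) ↔
      ∀ t : S ⊗[R] B, β.baseChange S t = 0 →
        ∃ y, α.baseChange S y = algebraMap R S a • t := by
  refine ⟨fun h t ht => ?_, fun h b hb => ?_⟩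
  · obtain ⟨u, rfl⟩ := (Module.Flat.lTensor_exact S (LinearMap.exact_subtype_ker_map β) t).1 ht
    clear ht
    induction u with
    | zero => exact ⟨0, by simp⟩
    | tmul s b =>
      obtain ⟨y, hy⟩ := h b b.2
      exact ⟨s ⊗ₜ y, by simp [hy]⟩
    | add u v hu hv =>
      obtain ⟨y, hy⟩ := hu
      obtain ⟨z, hz⟩ := hv
      exact ⟨y + z, by simp [hy, hz]⟩
  · obtain ⟨y, hy⟩ := h (1 ⊗ₜ b) (by simp [hb])
    rw [← LinearMap.mem_range, ← Submodule.Quotient.mk_eq_zero,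
      ← Module.FaithfullyFlat.one_tmul_eq_zero_iff R _ (A := S)]
    have h1 := (lTensor_exact S (f := α) (g := (LinearMap.range α).mkQ)
      (LinearMap.exact_map_mkQ_range α) (Submodule.mkQ_surjective _)).apply_apply_eq_zero y
    change LinearMap.lTensor S _ (α.baseChange S y) = 0 at h1
    rw [hy] at h1
    simpa using h1

section OfExact

variable {A : Type} [CommRing A] (X : ℕ → Type) [∀ n, AddCommGroup (X n)] [∀ n, Module A (X n)]
  (d : ∀ n, X (n + 1) →ₗ[A] X n)
  {M : Type} [AddCommGroup M] [Module A M] (p : X 0 →ₗ[A] M)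

/-- The chain complex underlying an exact sequence of modules. -/
noncomputable def ChainComplex.ofExact (h : ∀ n, Function.Exact (d (n + 1)) (d n)) :
    ChainComplex (ModuleCat.{0} A) ℕ :=
  ChainComplex.of (fun n => ModuleCat.of A (X n)) (fun n => ModuleCat.ofHom (d n))
    (fun n => ModuleCat.hom_ext (h n).linearMap_comp_eq_zero)

theorem ChainComplex.ofExact_d (h : ∀ n, Function.Exact (d (n + 1)) (d n)) (n : ℕ) :
    (ChainComplex.ofExact X d h).d (n + 1) n = ModuleCat.ofHom (d n) := by
  simp [ofExact, of_d]

variable [∀ n, Module.Projective A (X n)]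

/-- The projective resolution given by an exact sequence of projective modules. -/
noncomputable def CategoryTheory.ProjectiveResolution.ofExact (hp : Function.Surjective p)
    (h₀ : Function.Exact (d 0) p) (h : ∀ n, Function.Exact (d (n + 1)) (d n)) :
    ProjectiveResolution (ModuleCat.of A M) where
  complex := ChainComplex.ofExact X d h
  π := (ChainComplex.toSingle₀Equiv _ _).symm ⟨ModuleCat.ofHom p, by
    rw [ChainComplex.ofExact_d]; exact ModuleCat.hom_ext h₀.linearMap_comp_eq_zero⟩
  projective n := inferInstanceAs (Projective (ModuleCat.of A (X n)))
  quasiIso := ⟨fun n => by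
    cases n with
    | zero =>
      rw [ChainComplex.quasiIsoAt₀_iff, ShortComplex.quasiIso_iff_of_zeros' _ rfl rfl rfl]
      let T : ShortComplex (ModuleCat.{0} A) :=
        ShortComplex.mk (ModuleCat.ofHom (d 0)) (ModuleCat.ofHom p)
          (ModuleCat.hom_ext h₀.linearMap_comp_eq_zero)
      have hT : T.Exact ∧ Epi T.g :=
        ⟨(ShortComplex.moduleCat_exact_iff_range_eq_ker _).2 (LinearMap.exact_iff.1 h₀).symm,
          (ModuleCat.epi_iff_surjective _).2 hp⟩
      refine (ShortComplex.exact_and_epi_g_iff_of_iso (ShortComplex.isoMk (Iso.refl _)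
        (Iso.refl _) (Iso.refl _) ?_ ?_)).2 hT
      · exact (Category.id_comp _).trans
          ((ChainComplex.ofExact_d X d h 0).symm.trans (Category.comp_id _).symm)
      · refine (Category.id_comp _).trans (Eq.trans ?_ (Category.comp_id _).symm)
        exact (ChainComplex.toSingle₀Equiv_symm_apply_f_zero (V := ModuleCat.{0} A) _ _).symm
    | succ n =>
      rw [quasiIsoAt_iff_exactAt' _ _ (ChainComplex.exactAt_succ_single_obj _ _),
        HomologicalComplex.exactAt_iff' _ (n + 1 + 1) (n + 1) n (by simp) (by simp),
        ShortComplex.moduleCat_exact_iff_range_eq_ker]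
      simp only [HomologicalComplex.sc', HomologicalComplex.shortComplexFunctor',
        ChainComplex.ofExact_d]
      exact (LinearMap.exact_iff.1 (h n)).symm⟩

theorem forall_smul_extMod_zero_eq_zero_iff (hp : Function.Surjective p)
    (h₀ : Function.Exact (d 0) p) (h : ∀ n, Function.Exact (d (n + 1)) (d n))
    (N : Type) [AddCommGroup N] [Module A N] (a : A) :
    (∀ x : ExtMod A 0 (ModuleCat.of A M) (ModuleCat.of A N), a • x = 0) ↔
      ∀ f : X 0 →ₗ[A] N, f ∘ₗ d 0 = 0 →
        ∃ g : X 0 →ₗ[A] N, g ∘ₗ (0 : X 0 →ₗ[A] X 0) = a • f := by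
  have key := forall_smul_extMod_eq_zero_iff (N := ModuleCat.of A N)
    (ProjectiveResolution.ofExact X d p hp h₀ h) a (m := 0) (n := 0) (by simp)
  rw [HomologicalComplex.shape _ 0 0 (by simp)] at key
  change _ ↔ ∀ f : X 0 →ₗ[A] N, f ∘ₗ ((ChainComplex.ofExact X d h).d 1 0).hom = 0 → _ at key
  rw [ChainComplex.ofExact_d] at key
  exact key

theorem forall_smul_extMod_succ_eq_zero_iff (hp : Function.Surjective p)
    (h₀ : Function.Exact (d 0) p) (h : ∀ n, Function.Exact (d (n + 1)) (d n))
    (N : Type) [AddCommGroup N] [Module A N] (a : A) (n : ℕ) :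
    (∀ x : ExtMod A (n + 1) (ModuleCat.of A M) (ModuleCat.of A N), a • x = 0) ↔
      ∀ f : X (n + 1) →ₗ[A] N, f ∘ₗ d (n + 1) = 0 →
        ∃ g : X n →ₗ[A] N, g ∘ₗ d n = a • f := by
  have key := forall_smul_extMod_eq_zero_iff (N := ModuleCat.of A N)
    (ProjectiveResolution.ofExact X d p hp h₀ h) a (m := n) (n := n + 1) (by simp)
  change _ ↔ ∀ f : X (n + 1) →ₗ[A] N,
    f ∘ₗ ((ChainComplex.ofExact X d h).d (n + 1 + 1) (n + 1)).hom = 0 →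
      ∃ g : X n →ₗ[A] N, g ∘ₗ ((ChainComplex.ofExact X d h).d (n + 1) n).hom = a • f at key
  rw [ChainComplex.ofExact_d, ChainComplex.ofExact_d] at key
  exact key

end OfExact

theorem LinearMap.forall_exists_comp_iff_baseChange {R : Type*} (S : Type*) {X₀ X₁ X₂ N : Type*}
    [CommRing R] [CommRing S] [Algebra R S] [Module.FaithfullyFlat R S]
    [AddCommGroup X₀] [AddCommGroup X₁] [AddCommGroup X₂] [AddCommGroup N]
    [Module R X₀] [Module R X₁] [Module R X₂] [Module R N]
    [Module.FinitePresentation R X₀] [Module.FinitePresentation R X₁]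
    [Module.FinitePresentation R X₂] (d : X₂ →ₗ[R] X₁) (d' : X₁ →ₗ[R] X₀) (a : R) :
    (∀ f : X₁ →ₗ[R] N, f ∘ₗ d = 0 → ∃ g : X₀ →ₗ[R] N, g ∘ₗ d' = a • f) ↔
      ∀ f : S ⊗[R] X₁ →ₗ[S] S ⊗[R] N, f ∘ₗ d.baseChange S = 0 →
        ∃ g : S ⊗[R] X₀ →ₗ[S] S ⊗[R] N, g ∘ₗ d'.baseChange S = algebraMap R S a • f := by
  let e₀ := (Module.FinitePresentation.isBaseChange_map R X₀ N S).equiv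
  let e₁ := (Module.FinitePresentation.isBaseChange_map R X₁ N S).equiv
  let e₂ := (Module.FinitePresentation.isBaseChange_map R X₂ N S).equiv
  have h₁ (t) : e₂ ((d.lcomp R N).baseChange S t) = e₁ t ∘ₗ d.baseChange S := by
    induction t with
    | zero => simp
    | tmul s f => simp [e₁, e₂, IsBaseChange.equiv_tmul, smul_comp, LinearMap.lcomp_apply', baseChange_comp]
    | add u v hu hv => simp [hu, hv, add_comp]
  have h₀ (t) : e₁ ((d'.lcomp R N).baseChange S t) = e₀ t ∘ₗ d'.baseChange S := by
    induction t with
    | zero => simp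
    | tmul s f => simp [e₁, e₀, IsBaseChange.equiv_tmul, smul_comp, LinearMap.lcomp_apply', baseChange_comp]
    | add u v hu hv => simp [hu, hv, add_comp]
  refine (forall_exists_smul_iff_baseChange (S := S) (d'.lcomp R N) (d.lcomp R N) a).trans ?_
  rw [← e₁.toEquiv.forall_congr_right]
  refine forall_congr' fun t => imp_congr ?_ ?_
  · rw [← e₂.map_eq_zero_iff, h₁]; rfl
  · rw [← e₀.toEquiv.exists_congr_right]
    refine exists_congr fun y => ?_
    rw [← e₁.injective.eq_iff, h₀, map_smul]; rfl

theorem exists_finite_free_resolution (R : Type) [CommRing R] [IsNoetherianRing R] (M : Type)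
    [AddCommGroup M] [Module R M] [Module.Finite R M] :
    ∃ (s : ℕ → ℕ) (d : ∀ n, (Fin (s (n + 1)) → R) →ₗ[R] (Fin (s n) → R))
      (p : (Fin (s 0) → R) →ₗ[R] M), Function.Surjective p ∧ Function.Exact (d 0) p ∧
        ∀ n, Function.Exact (d (n + 1)) (d n) := by
  have cover (Z : {Z : ModuleCat.{0} R // Module.Finite R Z}) :
      ∃ (s : ℕ) (p : (Fin s → R) →ₗ[R] Z.1), Function.Surjective p :=
    have := Z.2
    Module.Finite.exists_fin' R Z.1
  choose s p hp using cover
  let next (Z : {Z : ModuleCat.{0} R // Module.Finite R Z}) :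
      {Z : ModuleCat.{0} R // Module.Finite R Z} :=
    ⟨ModuleCat.of R (LinearMap.ker (p Z)), inferInstanceAs (Module.Finite R (LinearMap.ker (p Z)))⟩
  let Z (n : ℕ) : {Z : ModuleCat.{0} R // Module.Finite R Z} :=
    Nat.rec ⟨ModuleCat.of R M, ‹_›⟩ (fun _ => next) n
  let d (n : ℕ) : (Fin (s (Z (n + 1))) → R) →ₗ[R] (Fin (s (Z n)) → R) :=
    (LinearMap.ker (p (Z n))).subtype ∘ₗ p (Z (n + 1))
  have hd (n : ℕ) : Function.Exact (d n) (p (Z n)) :=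
    fun y =>
    (LinearMap.exact_subtype_ker_map (p (Z n)) y).trans
      (Set.ext_iff.1 ((hp (Z (n + 1))).range_comp _).symm y)
  refine ⟨fun n => s (Z n), d, p (Z 0), hp (Z 0), hd 0, fun n => ?_⟩
  exact (hd (n + 1)).comp_injective _ (Submodule.injective_subtype _) (map_zero _)

/-- Flat base change for annihilators of Ext of a module against its n-th syzygy:
ann_R Ext^n_R(M, K) is the contraction of ann_S Ext^n_S(M ⊗ S, K ⊗ S). -/
theorem ann_ext_flat_baseChange (R S : Type) [CommRing R] [CommRing S]
    [IsNoetherianRing R] [IsNoetherianRing S] [IsLocalRing R] [IsLocalRing S]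
    [Algebra R S] [Module.Flat R S] (hloc : IsLocalHom (algebraMap R S))
    (M : Type) [AddCommGroup M] [Module R M] [Module.Finite R M]
    (n : ℕ) (K : Type) [AddCommGroup K] [Module R K] [Module.Finite R K]
    (hK : IsSyzygyCat R n (ModuleCat.of R K) (ModuleCat.of R M)) :
    ∀ a : R,
      (∀ x : ExtMod R n (ModuleCat.of R M) (ModuleCat.of R K), a • x = 0) ↔
      (∀ y : ExtMod S n (ModuleCat.of S (TensorProduct R S M))
          (ModuleCat.of S (TensorProduct R S K)), algebraMap R S a • y = 0) := by
  intro a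
  have : Module.FaithfullyFlat R S := Module.FaithfullyFlat.of_flat_of_isLocalHom
  obtain ⟨s, d, p, hp, h₀, h⟩ := exists_finite_free_resolution R M
  have hpS := LinearMap.lTensor_surjective S hp
  have h₀S := Module.Flat.lTensor_exact S h₀
  have hS (n : ℕ) := Module.Flat.lTensor_exact S (h n)
  cases n with
  | zero =>
    rw [forall_smul_extMod_zero_eq_zero_iff (fun n => Fin (s n) → R) d p hp h₀ h,
      forall_smul_extMod_zero_eq_zero_iff (fun n => S ⊗[R] (Fin (s n) → R))
        (fun n => (d n).baseChange S) (p.baseChange S) hpS h₀S hS]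
    simpa using LinearMap.forall_exists_comp_iff_baseChange (N := K) S (d 0)
      (0 : (Fin (s 0) → R) →ₗ[R] (Fin (s 0) → R)) a
  | succ n =>
    rw [forall_smul_extMod_succ_eq_zero_iff (fun n => Fin (s n) → R) d p hp h₀ h,
      forall_smul_extMod_succ_eq_zero_iff (fun n => S ⊗[R] (Fin (s n) → R))
        (fun n => (d n).baseChange S) (p.baseChange S) hpS h₀S hS]
    exact LinearMap.forall_exists_comp_iff_baseChange S (d (n + 1)) (d n) a
end
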